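/- (Openness for one disk) Let Γ^t, t in an interval I, be a smooth family of graphical tori. Let g^{t₀} : Δ̄ → ℂ be continuous, holomorphic on Δ, defining a holomorphic disk with trace in Γ^{t₀}, with g^{t₀} ∈ C^{1,α}(Δ̄) and g^{t₀}(λ) ≠ 0 for all λ ∈ Δ. Then there exist δ > 0 and a continuous function g : Δ̄ × (t₀ − δ, t₀ + δ) → ℂ with g(·, t₀) = g^{t₀} such that for each t, g^t := g(·,t) defines a holomorphic disk with trace in Γ^t, g^t ∈ C^{1,α}(Δ̄), and g^t(λ) ≠ 0 for all λ ∈ Δ. -/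

import Mathlib

open Set Metric Complex

noncomputable section

/-- The closed curve `c` (periodic of period `2π`) has winding number `1` around `0`:
there is a continuous lift of the argument increasing by `2π` over one period. -/
def WindingOne (c : ℝ → ℂ) : Prop :=
  ∃ θ : ℝ → ℝ, Continuous θ ∧
    (∀ t, c t = (‖c t‖ : ℂ) * Complex.exp ((θ t : ℂ) * Complex.I)) ∧
    θ (2 * Real.pi) = θ 0 + 2 * Real.pi

/-- `c : ℝ → ℂ` is a smooth simple closed curve (parametrized with period `2π`). -/
def IsSCC (c : ℝ → ℂ) : Prop :=
  ContDiff ℝ (⊤ : ℕ∞) c ∧ (∀ t, c (t + 2 * Real.pi) = c t) ∧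
    Set.InjOn c (Ico 0 (2 * Real.pi)) ∧ ∀ t, deriv c t ≠ 0

/-- `Γ ⊆ S¹ × ℂ` is a graphical torus: every vertical slice `C_λ` is a smooth simple
closed curve in `ℂ ∖ {0}` with winding number `1` around `0`. -/
def IsGraphicalTorus (Γ : Set (ℂ × ℂ)) : Prop :=
  (∀ p ∈ Γ, p.1 ∈ sphere (0 : ℂ) 1) ∧
  ∀ l ∈ sphere (0 : ℂ) 1, ∃ c : ℝ → ℂ,
    IsSCC c ∧ (∀ t, c t ≠ 0) ∧ WindingOne c ∧ Set.range c = {w : ℂ | (l, w) ∈ Γ}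

/-- `g` is continuous on the closed unit disk and holomorphic on the open unit disk,
hence defines a holomorphic disk `{(λ, g λ) : λ ∈ Δ}`. -/
def HolDisk (g : ℂ → ℂ) : Prop :=
  ContinuousOn g (closedBall (0 : ℂ) 1) ∧ DifferentiableOn ℂ g (ball (0 : ℂ) 1)

/-- The trace `{(λ, g λ) : λ ∈ S¹}` of the disk defined by `g` lies in `Γ`. -/
def DiskTraceIn (g : ℂ → ℂ) (Γ : Set (ℂ × ℂ)) : Prop :=
  ∀ l ∈ sphere (0 : ℂ) 1, (l, g l) ∈ Γ

/-- `f` is Hölder continuous with exponent `α` on `s`. -/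
def HolderOn (f : ℂ → ℂ) (s : Set ℂ) (α : ℝ) : Prop :=
  ∃ A : ℝ, ∀ x ∈ s, ∀ y ∈ s, ‖f x - f y‖ ≤ A * ‖x - y‖ ^ α

/-- `g ∈ C^{1,α}(Δ̄)`: the derivative of `g` extends to the closed unit disk as an
`α`-Hölder continuous function. -/
def C1AlphaOnDisk (g : ℂ → ℂ) (α : ℝ) : Prop :=
  ∃ g' : ℂ → ℂ, (∀ z ∈ ball (0 : ℂ) 1, HasDerivAt g (g' z) z) ∧
    ContinuousOn g' (closedBall (0 : ℂ) 1) ∧ HolderOn g' (closedBall (0 : ℂ) 1) α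

/-- The Wirtinger derivative `∂f/∂w = ½(∂f/∂x − i ∂f/∂y)` of `f : ℂ → ℝ`, as a complex number. -/
def wirt (f : ℂ → ℝ) (w : ℂ) : ℂ :=
  (((fderiv ℝ f w 1 : ℝ) : ℂ) - Complex.I * ((fderiv ℝ f w Complex.I : ℝ) : ℂ)) / 2

/-- The torus `Γ^t = {(λ, w) : λ ∈ S¹, F(λ,w) = t}` cut out by the defining function `F`. -/
def TorusOf (F : ℂ → ℂ → ℝ) (t : ℝ) : Set (ℂ × ℂ) :=
  {p : ℂ × ℂ | p.1 ∈ sphere (0 : ℂ) 1 ∧ F p.1 p.2 = t}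

/-- `F : S¹ × ℂ → ℝ` is a smooth defining function of a smooth family of graphical tori
`Γ^t = F⁻¹(t)`, `t > 0`: each slice level set is a smooth simple closed curve of winding
number `1` around `0`, the level sets foliate `ℂ ∖ {0}` for each fixed `λ ∈ S¹`,
`F(λ,w) = |w|²` near `w = 0`, and `∂F/∂w ≠ 0` for `w ≠ 0`. -/
def IsSmoothTorusFamily (F : ℂ → ℂ → ℝ) : Prop :=
  ContDiffOn ℝ (⊤ : ℕ∞) (fun p : ℂ × ℂ => F p.1 p.2) (sphere (0 : ℂ) 1 ×ˢ univ) ∧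
  (∀ l ∈ sphere (0 : ℂ) 1, ContDiff ℝ (⊤ : ℕ∞) (F l)) ∧
  (∃ ε : ℝ, 0 < ε ∧ ∀ l ∈ sphere (0 : ℂ) 1, ∀ w : ℂ,
      Complex.normSq w < ε → F l w = Complex.normSq w) ∧
  (∀ l ∈ sphere (0 : ℂ) 1, ∀ w : ℂ, w ≠ 0 → 0 < F l w) ∧
  (∀ l ∈ sphere (0 : ℂ) 1, ∀ w : ℂ, w ≠ 0 → wirt (F l) w ≠ 0) ∧
  (∀ l ∈ sphere (0 : ℂ) 1, ∀ t : ℝ, 0 < t → ∃ c : ℝ → ℂ,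
      IsSCC c ∧ (∀ s, c s ≠ 0) ∧ WindingOne c ∧ Set.range c = {w : ℂ | F l w = t})

section EnergyCalculus

open MeasureTheory Filter Topology

variable {E : Type*} [NormedAddCommGroup E] {G : Type*} [NormedAddCommGroup G]
  {H : Type*} [NormedAddCommGroup H] {H' : Type*} [NormedAddCommGroup H']

/-- The squared `L²` norm of `u` over one period `[0, 2π]`. -/
def energy (u : ℝ → E) : ℝ := ∫ θ in (0 : ℝ)..2 * Real.pi, ‖u θ‖ ^ 2

/-- `u` is Lipschitz in the `L²` sense under translations, with constant `√K`. This is the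
`H¹` seminorm of `u` in disguise. -/
def TransBound (u : ℝ → E) (K : ℝ) : Prop :=
  ∀ h, energy (fun θ => u (θ + h) - u θ) ≤ K * h ^ 2

theorem energy_nonneg (u : ℝ → E) : 0 ≤ energy u :=
  intervalIntegral.integral_nonneg Real.two_pi_pos.le fun _ _ => by positivity

theorem TransBound.nonneg {u : ℝ → E} {K : ℝ} (h : TransBound u K) : 0 ≤ K := by
  have := (energy_nonneg _).trans (h 1)
  simpa using this

theorem TransBound.mono {u : ℝ → E} {K K' : ℝ} (h : TransBound u K) (hK : K ≤ K') :
    TransBound u K' := fun t => (h t).trans (by gcongr)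

theorem intervalIntegrable_sq {u : ℝ → E} (hu : Continuous u) (a b : ℝ) :
    IntervalIntegrable (fun θ => ‖u θ‖ ^ 2) volume a b :=
  (hu.norm.pow 2).intervalIntegrable a b

/-- Pointwise domination of squares integrates to domination of energies. -/
theorem energy_le_of_sq_le {u : ℝ → E} {v₁ : ℝ → G} {v₂ : ℝ → H} {v₃ : ℝ → H'}
    (hu : Continuous u) (h₁ : Continuous v₁) (h₂ : Continuous v₂) (h₃ : Continuous v₃)
    {c₁ c₂ c₃ : ℝ}
    (h : ∀ θ, ‖u θ‖ ^ 2 ≤ c₁ * ‖v₁ θ‖ ^ 2 + c₂ * ‖v₂ θ‖ ^ 2 + c₃ * ‖v₃ θ‖ ^ 2) :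
    energy u ≤ c₁ * energy v₁ + c₂ * energy v₂ + c₃ * energy v₃ := by
  have i₁ := (intervalIntegrable_sq h₁ 0 (2 * Real.pi)).const_mul c₁
  have i₂ := (intervalIntegrable_sq h₂ 0 (2 * Real.pi)).const_mul c₂
  have i₃ := (intervalIntegrable_sq h₃ 0 (2 * Real.pi)).const_mul c₃
  simp only [energy, ← intervalIntegral.integral_const_mul]
  rw [← intervalIntegral.integral_add i₁ i₂, ← intervalIntegral.integral_add (i₁.add i₂) i₃]
  exact intervalIntegral.integral_mono Real.two_pi_pos.le (intervalIntegrable_sq hu _ _)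
    ((i₁.add i₂).add i₃) fun θ => h θ

theorem energy_le_of_sq_le_two {u : ℝ → E} {v₁ : ℝ → G} {v₂ : ℝ → H}
    (hu : Continuous u) (h₁ : Continuous v₁) (h₂ : Continuous v₂) {c₁ c₂ : ℝ}
    (h : ∀ θ, ‖u θ‖ ^ 2 ≤ c₁ * ‖v₁ θ‖ ^ 2 + c₂ * ‖v₂ θ‖ ^ 2) :
    energy u ≤ c₁ * energy v₁ + c₂ * energy v₂ := by
  have := energy_le_of_sq_le (c₃ := 0) hu h₁ h₂ h₂ (fun θ => by simpa using h θ)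
  simpa using this

theorem energy_le_of_sq_le_one {u : ℝ → E} {v₁ : ℝ → G}
    (hu : Continuous u) (h₁ : Continuous v₁) {c₁ : ℝ}
    (h : ∀ θ, ‖u θ‖ ^ 2 ≤ c₁ * ‖v₁ θ‖ ^ 2) :
    energy u ≤ c₁ * energy v₁ := by
  have := energy_le_of_sq_le_two (c₂ := 0) hu h₁ h₁ (fun θ => by simpa using h θ)
  simpa using this

theorem energy_const (c : E) : energy (fun _ => c) = 2 * Real.pi * ‖c‖ ^ 2 := by
  simp [energy]

theorem energy_const_smul [NormedSpace ℝ E] (c : ℝ) (u : ℝ → E) :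
    energy (fun θ => c • u θ) = c ^ 2 * energy u := by
  simp only [energy, norm_smul, mul_pow, intervalIntegral.integral_const_mul, Real.norm_eq_abs,
    sq_abs]

theorem energy_shift {u : ℝ → E} (hp : Function.Periodic u (2 * Real.pi)) (h : ℝ) :
    energy (fun θ => u (θ + h)) = energy u := by
  have hp' : Function.Periodic (fun θ => ‖u θ‖ ^ 2) (2 * Real.pi) := fun θ => by simp [hp θ]
  have := hp'.intervalIntegral_add_eq h 0
  simp only [energy]
  rw [intervalIntegral.integral_comp_add_right (fun θ => ‖u θ‖ ^ 2)]
  rw [zero_add, add_comm, this, zero_add]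

theorem energy_le_add {u : ℝ → E} {v : ℝ → E} (hu : Continuous u) (hv : Continuous v) :
    energy (fun θ => u θ + v θ) ≤ 2 * energy u + 2 * energy v := by
  refine energy_le_of_sq_le_two (by fun_prop) hu hv fun θ => ?_
  have := norm_add_le (u θ) (v θ)
  have h0 := norm_nonneg (u θ + v θ)
  nlinarith [sq_nonneg (‖u θ‖ - ‖v θ‖)]

theorem energy_le_sub {u : ℝ → E} {v : ℝ → E} (hu : Continuous u) (hv : Continuous v) :
    energy (fun θ => u θ - v θ) ≤ 2 * energy u + 2 * energy v := by
  have := energy_le_add hu hv.neg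
  simpa [sub_eq_add_neg, energy] using this

/-- Energies pass to bounded pointwise limits. -/
theorem energy_le_of_tendsto {ι : Type*} {l : Filter ι} [l.NeBot] [l.IsCountablyGenerated]
    {v : ι → ℝ → E} {u : ℝ → E} {M K : ℝ} (hv : ∀ᶠ i in l, Continuous (v i))
    (hM : ∀ᶠ i in l, ∀ θ, ‖v i θ‖ ≤ M)
    (hlim : ∀ θ, Tendsto (fun i => v i θ) l (𝓝 (u θ)))
    (hK : ∀ᶠ i in l, energy (v i) ≤ K) : energy u ≤ K := by
  refine le_of_tendsto (f := fun i => energy (v i)) ?_ hK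
  refine intervalIntegral.tendsto_integral_filter_of_dominated_convergence (fun _ => M ^ 2)
    ?_ ?_ (by simp) ?_
  · filter_upwards [hv] with i hi
    exact ((hi.norm.pow 2).aestronglyMeasurable).restrict
  · filter_upwards [hM] with i hi
    refine ae_of_all _ fun θ _ => ?_
    have := hi θ
    rw [Real.norm_of_nonneg (by positivity)]
    gcongr
  · refine ae_of_all _ fun θ _ => ?_
    exact ((hlim θ).norm.pow 2)

theorem TransBound.of_lipschitz {u : ℝ → E} {C : ℝ} (hu : Continuous u)
    (h : ∀ x y, ‖u x - u y‖ ≤ C * |x - y|) : TransBound u (2 * Real.pi * C ^ 2) := by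
  intro t
  have := energy_le_of_sq_le_one (u := fun θ => u (θ + t) - u θ) (v₁ := fun _ : ℝ => t)
    (c₁ := C ^ 2) (by fun_prop) (by fun_prop) (fun θ => by
      have h1 := h (θ + t) θ
      rw [add_sub_cancel_left] at h1
      have h0 := norm_nonneg (u (θ + t) - u θ)
      rw [Real.norm_eq_abs, ← mul_pow]
      gcongr)
  rw [energy_const] at this
  calc _ ≤ _ := this
    _ = _ := by rw [Real.norm_eq_abs, sq_abs]; ring

theorem TransBound.diff_quotient [NormedSpace ℝ E] {u : ℝ → E} {K : ℝ} (hc : Continuous u)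
    (hp : Function.Periodic u (2 * Real.pi)) (hu : TransBound u K) (h : ℝ) :
    TransBound (fun θ => h⁻¹ • (u (θ + h) - u θ)) (h⁻¹ ^ 2 * (4 * K)) := by
  intro t
  have e : (fun θ => h⁻¹ • (u (θ + t + h) - u (θ + t)) - h⁻¹ • (u (θ + h) - u θ))
      = fun θ => h⁻¹ • ((u (θ + h + t) - u (θ + h)) - (u (θ + t) - u θ)) := by
    funext θ
    rw [add_right_comm, ← smul_sub]
    congr 1
    abel
  rw [e, energy_const_smul, mul_assoc]
  refine mul_le_mul_of_nonneg_left ?_ (by positivity)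
  have hp' : Function.Periodic (fun θ => u (θ + t) - u θ) (2 * Real.pi) := fun θ => by
    simp only [add_right_comm θ, hp _]
  have h1 := energy_le_sub (u := fun θ => u (θ + h + t) - u (θ + h))
    (v := fun θ => u (θ + t) - u θ) (by fun_prop) (by fun_prop)
  have h2 : energy (fun θ => u (θ + h + t) - u (θ + h)) = energy (fun θ => u (θ + t) - u θ) :=
    energy_shift hp' h
  have h3 := hu t
  rw [h2] at h1
  linarith

end EnergyCalculus

section FourierCoefficients

open MeasureTheory Filter Topology

/-- The `n`-th Fourier coefficient of a `2π`-periodic function. -/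
def cf (u : ℝ → ℂ) (n : ℤ) : ℂ :=
  (1 / (2 * Real.pi)) • ∫ θ in (0 : ℝ)..2 * Real.pi, Complex.exp (-(n * θ * I)) * u θ

theorem fourier_neg_two_pi (n : ℤ) (x : ℝ) :
    fourier (-n) (x : AddCircle (2 * Real.pi)) = Complex.exp (-(n * x * I)) := by
  rw [fourier_coe_apply]
  congr 1
  have : (Real.pi : ℂ) ≠ 0 := by exact_mod_cast Real.pi_ne_zero
  push_cast
  field_simp

theorem fourier_two_pi (n : ℤ) (x : ℝ) :
    fourier n (x : AddCircle (2 * Real.pi)) = Complex.exp (n * x * I) := by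
  have := fourier_neg_two_pi (-n) x
  rw [neg_neg] at this
  rw [this]
  push_cast
  ring_nf

theorem cf_eq_fourierCoeffOn (u : ℝ → ℂ) (n : ℤ) :
    cf u n = fourierCoeffOn Real.two_pi_pos u n := by
  rw [fourierCoeffOn_eq_integral, sub_zero]
  simp only [cf, fourier_neg_two_pi, smul_eq_mul]

theorem hasSum_sq_cf {u : ℝ → ℂ} (hu : Continuous u) :
    HasSum (fun n => ‖cf u n‖ ^ 2) ((2 * Real.pi)⁻¹ * energy u) := by
  have hm : MemLp u 2 (volume.restrict (Ioc 0 (2 * Real.pi))) := by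
    obtain ⟨C, hC⟩ := (isCompact_Icc (a := (0 : ℝ)) (b := 2 * Real.pi)).exists_bound_of_continuousOn
      hu.continuousOn
    refine MemLp.of_bound hu.aestronglyMeasurable C ?_
    refine (ae_restrict_iff' measurableSet_Ioc).2 (ae_of_all _ fun x hx => ?_)
    exact hC x (Ioc_subset_Icc_self hx)
  have := hasSum_sq_fourierCoeffOn Real.two_pi_pos hm
  simpa only [cf_eq_fourierCoeffOn, sub_zero, smul_eq_mul, energy] using this

theorem sum_sq_cf_le {u : ℝ → ℂ} (hu : Continuous u) (s : Finset ℤ) :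
    ∑ n ∈ s, ‖cf u n‖ ^ 2 ≤ energy u := by
  have h1 := sum_le_hasSum s (fun _ _ => by positivity) (hasSum_sq_cf hu)
  have h2 : (2 * Real.pi)⁻¹ ≤ 1 := inv_le_one_of_one_le₀ (by linarith [Real.pi_gt_three])
  nlinarith [energy_nonneg u]

theorem hasSum_cf {u : ℝ → ℂ} (hu : Continuous u) (hp : Function.Periodic u (2 * Real.pi))
    (hs : Summable (cf u)) (θ : ℝ) :
    HasSum (fun n : ℤ => cf u n * Complex.exp (n * θ * I)) (u θ) := by
  have : Fact (0 < 2 * Real.pi) := ⟨Real.two_pi_pos⟩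
  let f : C(AddCircle (2 * Real.pi), ℂ) := ⟨hp.lift, continuous_coinduced_dom.mpr hu⟩
  have hf : ∀ x : ℝ, f (x : AddCircle (2 * Real.pi)) = u x := fun x => hp.lift_coe x
  have hc : fourierCoeff f = cf u := by
    funext n
    rw [fourierCoeff_eq_intervalIntegral _ _ 0, zero_add]
    simp only [cf, fourier_neg_two_pi, smul_eq_mul, hf]
  have := has_pointwise_sum_fourier_series_of_summable (f := f) (hc ▸ hs) (θ : AddCircle _)
  simpa only [hc, fourier_two_pi, hf, smul_eq_mul] using this

theorem cf_shift {u : ℝ → ℂ} (hp : Function.Periodic u (2 * Real.pi)) (h : ℝ) (n : ℤ) :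
    cf (fun θ => u (θ + h)) n = Complex.exp (n * h * I) * cf u n := by
  have hp' : Function.Periodic (fun θ : ℝ => Complex.exp (-(n * θ * I)) * u θ)
      (2 * Real.pi) := fun θ => by
    simp only [hp θ]
    congr 1
    rw [Complex.exp_eq_exp_iff_exists_int]
    exact ⟨-n, by push_cast; ring⟩
  have e : ∀ θ : ℝ, Complex.exp (-(n * θ * I)) * u (θ + h)
      = Complex.exp (n * h * I) * (fun θ : ℝ => Complex.exp (-(n * θ * I)) * u θ) (θ + h) := by
    intro θ
    simp only
    rw [← mul_assoc, ← Complex.exp_add]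
    congr 2
    push_cast
    ring
  simp only [cf]
  rw [intervalIntegral.integral_congr (fun θ _ => e θ), intervalIntegral.integral_const_mul,
    intervalIntegral.integral_comp_add_right
      (fun θ : ℝ => Complex.exp (-(n * θ * I)) * u θ)]
  have := hp'.intervalIntegral_add_eq h 0
  rw [zero_add, add_comm _ h, this, zero_add, Complex.real_smul, Complex.real_smul]
  ring

theorem cf_sub {u v : ℝ → ℂ} (hu : Continuous u) (hv : Continuous v) (n : ℤ) :
    cf (fun θ => u θ - v θ) n = cf u n - cf v n := by
  simp only [cf, mul_sub]
  rw [intervalIntegral.integral_sub, smul_sub]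
  · exact Continuous.intervalIntegrable (by fun_prop) _ _
  · exact Continuous.intervalIntegrable (by fun_prop) _ _

theorem cf_smul (c : ℝ) (u : ℝ → ℂ) (n : ℤ) :
    cf (fun θ => c • u θ) n = c • cf u n := by
  simp only [cf, mul_smul_comm, intervalIntegral.integral_smul, smul_comm c]

theorem cf_diff {u : ℝ → ℂ} (hu : Continuous u) (hp : Function.Periodic u (2 * Real.pi))
    (h : ℝ) (n : ℤ) :
    cf (fun θ => u (θ + h) - u θ) n = (Complex.exp (n * h * I) - 1) * cf u n := by
  rw [cf_sub (by fun_prop) hu, cf_shift hp]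
  ring

theorem tendsto_exp_slope (n : ℤ) :
    Tendsto (fun h : ℝ => ‖(h⁻¹ : ℂ) * (Complex.exp (n * h * I) - 1)‖) (𝓝[≠] 0)
      (𝓝 |(n : ℝ)|) := by
  have hd : HasDerivAt (fun h : ℝ => Complex.exp (n * h * I)) (n * I) 0 := by
    have h1 : HasDerivAt (fun h : ℝ => ((n : ℂ) * (h : ℂ) * I)) (n * I) (0 : ℝ) := by
      have := ((Complex.ofRealCLM.hasDerivAt (x := (0 : ℝ))).const_mul (n : ℂ)).mul_const I
      simpa using this
    simpa using h1.cexp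
  have := (hasDerivAt_iff_tendsto_slope.1 hd).norm
  have e : ‖(n : ℂ) * I‖ = |(n : ℝ)| := by simp
  rw [e] at this
  refine this.congr fun h => ?_
  simp [slope_def_module]

/-- The Sobolev bound on Fourier coefficients given by an `L²` Lipschitz bound. -/
theorem TransBound.sum_cf_le {u : ℝ → ℂ} {K : ℝ} (hu : Continuous u)
    (hp : Function.Periodic u (2 * Real.pi)) (hK : TransBound u K) (s : Finset ℤ) :
    ∑ n ∈ s, (n : ℝ) ^ 2 * ‖cf u n‖ ^ 2 ≤ K := by
  have hlim : Tendsto (fun h : ℝ => ∑ n ∈ s,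
      ‖(h⁻¹ : ℂ) * (Complex.exp (n * h * I) - 1)‖ ^ 2 * ‖cf u n‖ ^ 2) (𝓝[≠] 0)
      (𝓝 (∑ n ∈ s, |(n : ℝ)| ^ 2 * ‖cf u n‖ ^ 2)) :=
    tendsto_finsetSum _ fun n _ => ((tendsto_exp_slope n).pow 2).mul_const _
  simp only [sq_abs] at hlim
  refine le_of_tendsto hlim ?_
  filter_upwards [self_mem_nhdsWithin] with h hh
  have hh : h ≠ 0 := hh
  have h1 := (sum_sq_cf_le (u := fun θ => u (θ + h) - u θ) (by fun_prop) s).trans (hK h)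
  simp only [cf_diff hu hp] at h1
  have h2 : ∀ n : ℤ, ‖(h⁻¹ : ℂ) * (Complex.exp (n * h * I) - 1)‖ ^ 2 * ‖cf u n‖ ^ 2
      = (h ^ 2)⁻¹ * ‖(Complex.exp (n * h * I) - 1) * cf u n‖ ^ 2 := by
    intro n
    rw [norm_mul, norm_mul, norm_inv, Complex.norm_real, Real.norm_eq_abs, mul_pow, mul_pow,
      inv_pow, sq_abs]
    ring
  simp only [h2]
  rw [← Finset.mul_sum, inv_mul_le_iff₀ (by positivity)]
  linarith

/-- The second order Sobolev bound on Fourier coefficients, from difference quotients. -/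
theorem sum_cf_le_of_diff_quotient {u : ℝ → ℂ} {K : ℝ} (hu : Continuous u)
    (hp : Function.Periodic u (2 * Real.pi))
    (hK : ∀ᶠ h : ℝ in 𝓝[≠] 0, TransBound (fun θ => h⁻¹ • (u (θ + h) - u θ)) K) (s : Finset ℤ) :
    ∑ n ∈ s, (n : ℝ) ^ 4 * ‖cf u n‖ ^ 2 ≤ K := by
  have hlim : Tendsto (fun h : ℝ => ∑ n ∈ s, (n : ℝ) ^ 2 *
      (‖(h⁻¹ : ℂ) * (Complex.exp (n * h * I) - 1)‖ ^ 2 * ‖cf u n‖ ^ 2)) (𝓝[≠] 0)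
      (𝓝 (∑ n ∈ s, (n : ℝ) ^ 2 * (|(n : ℝ)| ^ 2 * ‖cf u n‖ ^ 2))) :=
    tendsto_finsetSum _ fun n _ => (((tendsto_exp_slope n).pow 2).mul_const _).const_mul _
  have e : ∀ n : ℤ, (n : ℝ) ^ 2 * (|(n : ℝ)| ^ 2 * ‖cf u n‖ ^ 2) = (n : ℝ) ^ 4 * ‖cf u n‖ ^ 2 :=
    fun n => by rw [sq_abs]; ring
  simp only [e] at hlim
  refine le_of_tendsto hlim ?_
  filter_upwards [self_mem_nhdsWithin, hK] with h hh hKh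
  have hp' : Function.Periodic (fun θ => h⁻¹ • (u (θ + h) - u θ)) (2 * Real.pi) := fun θ => by
    simp only [add_right_comm θ, hp _]
  have h1 := hKh.sum_cf_le (by fun_prop) hp' s
  refine le_trans (le_of_eq (Finset.sum_congr rfl fun n _ => ?_)) h1
  rw [cf_smul, cf_diff hu hp, norm_mul, norm_smul, norm_mul, norm_inv, norm_inv,
    Complex.norm_real]
  ring

/-- The weights used in the Sobolev embedding. -/
theorem summable_weight :
    Summable fun n : ℤ => (1 + |(n : ℝ)| ^ (3 / 2 : ℝ))⁻¹ := by
  have h := Real.summable_abs_int_rpow (b := 3 / 2) (by norm_num)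
  refine Summable.of_norm_bounded_eventually h ?_
  rw [Filter.eventually_cofinite]
  refine (Set.finite_singleton (0 : ℤ)).subset fun n hn => ?_
  by_contra hn0
  apply hn
  have hpos : 0 < |(n : ℝ)| := abs_pos.2 (by exact_mod_cast hn0)
  rw [Real.norm_of_nonneg (by positivity), Real.rpow_neg hpos.le]
  have : 0 < |(n : ℝ)| ^ (3 / 2 : ℝ) := by positivity
  gcongr
  linarith

theorem weight_le {x μ : ℝ} (hx : 0 ≤ x) (hμ : 0 < μ) (hμ1 : μ ≤ 1) :
    1 + x ^ (3 / 2 : ℝ) ≤ μ * x ^ 2 + 2 * μ⁻¹ ^ 3 := by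
  obtain ⟨y, hy, rfl⟩ : ∃ y : ℝ, 0 ≤ y ∧ x = y ^ 2 := ⟨√x, Real.sqrt_nonneg x, (Real.sq_sqrt hx).symm⟩
  have e : (y ^ 2) ^ (3 / 2 : ℝ) = y ^ 3 := by
    rw [← Real.rpow_natCast_mul hy]
    norm_num
  rw [e]
  have hν : 1 ≤ μ⁻¹ := (one_le_inv₀ hμ).2 hμ1
  have h3 : 1 ≤ μ⁻¹ ^ 3 := one_le_pow₀ hν
  rcases le_total y μ⁻¹ with h | h
  · have : y ^ 3 ≤ μ⁻¹ ^ 3 := by gcongr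
    have : 0 ≤ μ * (y ^ 2) ^ 2 := by positivity
    linarith
  · have h1 : 1 ≤ μ * y := by
      have := mul_le_mul_of_nonneg_left h hμ.le
      rwa [mul_inv_cancel₀ hμ.ne'] at this
    have : y ^ 3 * 1 ≤ y ^ 3 * (μ * y) := by gcongr
    nlinarith

theorem sum_norm_cf_sq_le {u : ℝ → ℂ} {K : ℝ} (hu : Continuous u)
    (hp : Function.Periodic u (2 * Real.pi)) (hK : TransBound u K) {μ : ℝ} (hμ : 0 < μ)
    (hμ1 : μ ≤ 1) (s : Finset ℤ) :
    (∑ n ∈ s, ‖cf u n‖) ^ 2 ≤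
      (∑' n : ℤ, (1 + |(n : ℝ)| ^ (3 / 2 : ℝ))⁻¹) * (μ * K + 2 * μ⁻¹ ^ 3 * energy u) := by
  set w : ℤ → ℝ := fun n => 1 + |(n : ℝ)| ^ (3 / 2 : ℝ) with hw
  have hwpos : ∀ n, 0 < w n := fun n => by positivity
  have h1 : (∑ n ∈ s, ‖cf u n‖) ^ 2 ≤ (∑ n ∈ s, (w n)⁻¹) * ∑ n ∈ s, w n * ‖cf u n‖ ^ 2 :=
    Finset.sum_sq_le_sum_mul_sum_of_sq_le_mul s (fun n _ => by have := hwpos n; positivity)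
      (fun n _ => by have := hwpos n; positivity) fun n _ => by
        have := (hwpos n).ne'
        rw [inv_mul_cancel_left₀ this]
  have h2 : ∑ n ∈ s, w n * ‖cf u n‖ ^ 2 ≤ μ * K + 2 * μ⁻¹ ^ 3 * energy u := by
    calc ∑ n ∈ s, w n * ‖cf u n‖ ^ 2
        ≤ ∑ n ∈ s, (μ * ((n : ℝ) ^ 2 * ‖cf u n‖ ^ 2) + 2 * μ⁻¹ ^ 3 * ‖cf u n‖ ^ 2) := by
          refine Finset.sum_le_sum fun n _ => ?_
          have := weight_le (abs_nonneg (n : ℝ)) hμ hμ1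
          rw [sq_abs] at this
          calc w n * ‖cf u n‖ ^ 2 ≤ (μ * (n : ℝ) ^ 2 + 2 * μ⁻¹ ^ 3) * ‖cf u n‖ ^ 2 := by gcongr
            _ = _ := by ring
      _ = μ * ∑ n ∈ s, ((n : ℝ) ^ 2 * ‖cf u n‖ ^ 2) + 2 * μ⁻¹ ^ 3 * ∑ n ∈ s, ‖cf u n‖ ^ 2 := by
          rw [Finset.sum_add_distrib, Finset.mul_sum, Finset.mul_sum]
      _ ≤ _ := by
          gcongr
          · exact hK.sum_cf_le hu hp s
          · exact sum_sq_cf_le hu s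
  have h3 : ∑ n ∈ s, (w n)⁻¹ ≤ ∑' n, (w n)⁻¹ :=
    summable_weight.sum_le_tsum s fun n _ => by have := hwpos n; positivity
  have h4 : 0 ≤ ∑ n ∈ s, w n * ‖cf u n‖ ^ 2 :=
    Finset.sum_nonneg fun n _ => by have := hwpos n; positivity
  have h5 : 0 ≤ ∑' n, (w n)⁻¹ := tsum_nonneg fun n => by have := hwpos n; positivity
  exact h1.trans (mul_le_mul h3 h2 h4 h5)

theorem TransBound.summable_cf {u : ℝ → ℂ} {K : ℝ} (hu : Continuous u)
    (hp : Function.Periodic u (2 * Real.pi)) (hK : TransBound u K) :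
    Summable fun n => ‖cf u n‖ :=
  summable_of_sum_le (fun _ => norm_nonneg _) fun s =>
    Real.le_sqrt_of_sq_le (sum_norm_cf_sq_le hu hp hK one_pos le_rfl s)

/-- The constant of the Sobolev embedding `H¹ ⊆ L^∞` on the circle. -/
def sobolevConst : ℝ := ∑' n : ℤ, (1 + |(n : ℝ)| ^ (3 / 2 : ℝ))⁻¹

theorem sobolevConst_nonneg : 0 ≤ sobolevConst := tsum_nonneg fun n => by positivity

/-- Sobolev embedding, in interpolated form. -/
theorem TransBound.norm_sq_le {u : ℝ → ℂ} {K : ℝ} (hu : Continuous u)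
    (hp : Function.Periodic u (2 * Real.pi)) (hK : TransBound u K) {μ : ℝ} (hμ : 0 < μ)
    (hμ1 : μ ≤ 1) (θ : ℝ) :
    ‖u θ‖ ^ 2 ≤ sobolevConst * (μ * K + 2 * μ⁻¹ ^ 3 * energy u) := by
  have hs := hK.summable_cf hu hp
  have h1 := hasSum_cf hu hp hs.of_norm θ
  have e : ∀ n : ℤ, ‖cf u n * Complex.exp (n * θ * I)‖ = ‖cf u n‖ := fun n => by
    have : ((n : ℂ) * θ * I) = ((n * θ : ℝ) : ℂ) * I := by push_cast; ring
    rw [norm_mul, this, Complex.norm_exp_ofReal_mul_I, mul_one]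
  have h2 : ‖u θ‖ ≤ ∑' n, ‖cf u n‖ := by
    rw [← h1.tsum_eq]
    refine (norm_tsum_le_tsum_norm (by simpa only [e] using hs)).trans (le_of_eq ?_)
    simp only [e]
  have hB : 0 ≤ sobolevConst * (μ * K + 2 * μ⁻¹ ^ 3 * energy u) := by
    have := energy_nonneg u
    have := hK.nonneg
    have := sobolevConst_nonneg
    positivity
  have h3 : ∑' n, ‖cf u n‖ ≤ √(sobolevConst * (μ * K + 2 * μ⁻¹ ^ 3 * energy u)) :=
    hs.tsum_le_of_sum_le fun s =>
      Real.le_sqrt_of_sq_le (sum_norm_cf_sq_le hu hp hK hμ hμ1 s)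
  calc ‖u θ‖ ^ 2 ≤ √(sobolevConst * (μ * K + 2 * μ⁻¹ ^ 3 * energy u)) ^ 2 := by
        gcongr
        exact h2.trans h3
    _ = _ := Real.sq_sqrt hB

end FourierCoefficients

section HolomorphicDisks

open MeasureTheory Filter Topology

/-- The boundary values of `f`, as a `2π`-periodic function. -/
def bd (f : ℂ → ℂ) : ℝ → ℂ := fun θ => f (circleMap 0 1 θ)

theorem bd_periodic (f : ℂ → ℂ) : Function.Periodic (bd f) (2 * Real.pi) := fun θ => by
  simp only [bd, periodic_circleMap 0 1 θ]

theorem circleMap_mem_closedBall_one (θ : ℝ) : circleMap 0 1 θ ∈ closedBall (0 : ℂ) 1 :=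
  circleMap_mem_closedBall 0 zero_le_one θ

theorem HolDisk.continuous_bd {f : ℂ → ℂ} (hf : HolDisk f) : Continuous (bd f) :=
  hf.1.comp_continuous (continuous_circleMap 0 1) circleMap_mem_closedBall_one

theorem holDisk_iff {f : ℂ → ℂ} : HolDisk f ↔ DiffContOnCl ℂ f (ball 0 1) := by
  constructor
  · rintro ⟨h1, h2⟩
    exact ⟨h2, by rwa [closure_ball _ one_ne_zero]⟩
  · rintro ⟨h1, h2⟩
    exact ⟨by rwa [closure_ball _ one_ne_zero] at h2, h1⟩

theorem HolDisk.add {f g : ℂ → ℂ} (hf : HolDisk f) (hg : HolDisk g) :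
    HolDisk fun z => f z + g z := ⟨hf.1.add hg.1, hf.2.add hg.2⟩

theorem HolDisk.sub {f g : ℂ → ℂ} (hf : HolDisk f) (hg : HolDisk g) :
    HolDisk fun z => f z - g z := ⟨hf.1.sub hg.1, hf.2.sub hg.2⟩

theorem HolDisk.mul {f g : ℂ → ℂ} (hf : HolDisk f) (hg : HolDisk g) :
    HolDisk fun z => f z * g z := ⟨hf.1.mul hg.1, hf.2.mul hg.2⟩

theorem HolDisk.const_mul {f : ℂ → ℂ} (c : ℂ) (hf : HolDisk f) :
    HolDisk fun z => c * f z := ⟨hf.1.const_smul c, hf.2.const_mul c⟩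

theorem HolDisk.cexp {f : ℂ → ℂ} (hf : HolDisk f) : HolDisk fun z => Complex.exp (f z) :=
  ⟨hf.1.cexp, hf.2.cexp⟩

theorem HolDisk.const (c : ℂ) : HolDisk fun _ => c :=
  ⟨continuousOn_const, differentiableOn_const _⟩

theorem HolDisk.neg {f : ℂ → ℂ} (hf : HolDisk f) : HolDisk fun z => -f z := ⟨hf.1.neg, hf.2.neg⟩

theorem HolDisk.pow_mul {f : ℂ → ℂ} (n : ℕ) (hf : HolDisk f) : HolDisk fun z => z ^ n * f z :=
  ⟨(continuousOn_pow n).mul hf.1, (differentiableOn_pow n).mul hf.2⟩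

/-- The disk rotated by the angle `h`. -/
theorem HolDisk.rotate {f : ℂ → ℂ} (hf : HolDisk f) (h : ℝ) :
    HolDisk fun z => f (Complex.exp (h * I) * z) := by
  have hn : ∀ z : ℂ, ‖Complex.exp (h * I) * z‖ = ‖z‖ := fun z => by
    rw [norm_mul, Complex.norm_exp_ofReal_mul_I, one_mul]
  constructor
  · exact hf.1.comp (by fun_prop) fun z hz => by simpa [hn] using hz
  · exact hf.2.comp (by fun_prop) fun z hz => by simpa [hn] using hz

theorem bd_rotate (f : ℂ → ℂ) (h : ℝ) :
    bd (fun z => f (Complex.exp (h * I) * z)) = fun θ => bd f (θ + h) := by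
  funext θ
  simp only [bd, circleMap_zero, ofReal_one, one_mul, ← Complex.exp_add]
  congr 2
  push_cast
  ring

theorem HolDisk.integral_bd {f : ℂ → ℂ} (hf : HolDisk f) :
    ∫ θ in (0 : ℝ)..2 * Real.pi, bd f θ = 2 * Real.pi * f 0 := by
  have h := (show DiffContOnCl ℂ f (ball 0 |1|) by rw [abs_one]; exact holDisk_iff.1 hf).circleAverage
  rw [Real.circleAverage_def] at h
  rw [← h, Complex.real_smul]
  have : (Real.pi : ℂ) ≠ 0 := by exact_mod_cast Real.pi_ne_zero
  push_cast
  field_simp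
  rfl

/-- For a holomorphic disk the energy of the boundary values is controlled by the real part. -/
theorem HolDisk.energy_eq {f : ℂ → ℂ} (hf : HolDisk f) :
    energy (bd f) = 2 * energy (fun θ => (bd f θ).re) - 2 * Real.pi * (f 0 ^ 2).re := by
  have h := (hf.mul hf).integral_bd
  have hc := hf.continuous_bd
  have h2 := congrArg Complex.re h
  have h3 : ∫ θ in (0 : ℝ)..2 * Real.pi, (bd (fun z => f z * f z) θ).re
      = (∫ θ in (0 : ℝ)..2 * Real.pi, bd (fun z => f z * f z) θ).re :=
    intervalIntegral.intervalIntegral_re (𝕜 := ℂ) ((hf.mul hf).continuous_bd.intervalIntegrable _ _)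
  rw [← h3] at h2
  have e : ∀ θ, ‖bd f θ‖ ^ 2
      = 2 * ‖(bd f θ).re‖ ^ 2 - (bd (fun z => f z * f z) θ).re := fun θ => by
    rw [Complex.sq_norm, Complex.normSq_apply, Real.norm_eq_abs, sq_abs]
    simp only [bd, Complex.mul_re]
    ring
  have h4 : (2 * (Real.pi : ℂ) * (f 0 * f 0)).re = 2 * Real.pi * (f 0 ^ 2).re := by
    have : (2 * (Real.pi : ℂ) * (f 0 * f 0)) = ((2 * Real.pi : ℝ) : ℂ) * (f 0 ^ 2) := by
      push_cast; ring
    rw [this, Complex.re_ofReal_mul]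
  rw [h4] at h2
  simp only [energy, e]
  rw [intervalIntegral.integral_sub, intervalIntegral.integral_const_mul, h2]
  · exact Continuous.intervalIntegrable (by fun_prop) _ _
  · exact (Complex.continuous_re.comp (hf.mul hf).continuous_bd).intervalIntegrable _ _

theorem HolDisk.energy_le {f : ℂ → ℂ} (hf : HolDisk f) (h0 : (f 0).im = 0) :
    energy (bd f) ≤ 2 * energy (fun θ => (bd f θ).re) := by
  rw [hf.energy_eq]
  have : 0 ≤ (f 0 ^ 2).re := by
    rw [sq, Complex.mul_re, h0]
    simpa using mul_self_nonneg (f 0).re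
  have := mul_nonneg Real.two_pi_pos.le this
  linarith

theorem HolDisk.transBound {f : ℂ → ℂ} (hf : HolDisk f) {K : ℝ}
    (hK : TransBound (fun θ => (bd f θ).re) K) : TransBound (bd f) (2 * K) := by
  intro h
  have h1 := ((hf.rotate h).sub hf).energy_eq
  have e : bd (fun z => f (Complex.exp (h * I) * z) - f z) = fun θ => bd f (θ + h) - bd f θ := by
    have := bd_rotate f h
    funext θ
    rw [← congrFun this θ]
    rfl
  rw [e] at h1
  have h2 := hK h
  simp only [mul_zero, sub_self, sub_re] at h1 h2
  rw [h1]
  simp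
  linarith

/-- The sum of the power series with coefficients `a`. -/
def powSum (a : ℕ → ℂ) (z : ℂ) : ℂ := ∑' n, a n * z ^ n

theorem norm_mul_pow_le (a : ℕ → ℂ) {z : ℂ} (hz : z ∈ closedBall (0 : ℂ) 1) (n : ℕ) :
    ‖a n * z ^ n‖ ≤ ‖a n‖ := by
  rw [norm_mul, norm_pow]
  have : ‖z‖ ^ n ≤ 1 := pow_le_one₀ (norm_nonneg z) (by simpa using hz)
  exact mul_le_of_le_one_right (norm_nonneg _) this

theorem hasSum_powSum {a : ℕ → ℂ} (ha : Summable fun n => ‖a n‖) {z : ℂ}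
    (hz : z ∈ closedBall (0 : ℂ) 1) : HasSum (fun n => a n * z ^ n) (powSum a z) :=
  (Summable.of_norm_bounded ha (norm_mul_pow_le a hz)).hasSum

theorem holDisk_powSum {a : ℕ → ℂ} (ha : Summable fun n => ‖a n‖) : HolDisk (powSum a) := by
  constructor
  · exact continuousOn_tsum (fun n => by fun_prop) ha fun n z hz => norm_mul_pow_le a hz n
  · exact differentiableOn_tsum_of_summable_norm ha (fun n => by fun_prop) isOpen_ball
      fun n z hz => norm_mul_pow_le a (ball_subset_closedBall hz) n

theorem cf_conj {b : ℝ → ℝ} (n : ℤ) :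
    cf (fun θ => (b θ : ℂ)) (-n) = (starRingEnd ℂ) (cf (fun θ => (b θ : ℂ)) n) := by
  simp only [cf, Complex.real_smul, map_mul, Complex.conj_ofReal]
  congr 1
  rw [intervalIntegral.integral_of_le Real.two_pi_pos.le,
    intervalIntegral.integral_of_le Real.two_pi_pos.le, ← integral_conj]
  refine integral_congr_ae (ae_of_all _ fun θ => ?_)
  simp only [map_mul, Complex.conj_ofReal, ← Complex.exp_conj, map_neg, Complex.conj_I]
  congr 2
  push_cast
  simp

theorem circleMap_pow_eq (θ : ℝ) (n : ℕ) :
    circleMap 0 1 θ ^ n = Complex.exp ((n : ℤ) * θ * I) := by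
  rw [circleMap_zero, ofReal_one, one_mul, ← Complex.exp_nat_mul]
  congr 1
  push_cast
  ring

/-- The Schwarz extension: every `H¹` real function on the circle is the real part of the
boundary values of a holomorphic disk. -/
theorem exists_holDisk_re {b : ℝ → ℝ} {K : ℝ} (hb : Continuous b)
    (hp : Function.Periodic b (2 * Real.pi)) (hK : TransBound b K) :
    ∃ f : ℂ → ℂ, HolDisk f ∧ (∀ θ, (bd f θ).re = b θ) ∧ (f 0).im = 0 := by
  set u : ℝ → ℂ := fun θ => (b θ : ℂ) with hu
  have huc : Continuous u := by fun_prop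
  have hup : Function.Periodic u (2 * Real.pi) := fun θ => by simp only [hu, hp θ]
  have huK : TransBound u K := fun h => by
    have := hK h
    simp only [energy] at this ⊢
    refine le_trans (le_of_eq ?_) this
    congr 1
    funext θ
    rw [hu, ← ofReal_sub, Complex.norm_real]
  have hs := huK.summable_cf huc hup
  have ha : Summable fun n : ℕ => ‖cf u n‖ := hs.comp_injective Nat.cast_injective
  have h0 : (cf u 0).im = 0 := by
    have := cf_conj (b := b) 0
    rw [neg_zero] at this
    exact Complex.conj_eq_iff_im.1 this.symm
  refine ⟨fun z => 2 * powSum (fun n => cf u n) z - cf u 0,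
    ((holDisk_powSum ha).const_mul 2).sub (HolDisk.const _), fun θ => ?_, ?_⟩
  · have h1 := (hasSum_cf huc hup hs.of_norm θ).nat_add_neg
    have h2 := hasSum_powSum ha (circleMap_mem_closedBall_one θ)
    have h3 := Complex.hasSum_re h1
    have h4 := (Complex.hasSum_re h2).mul_left 2
    have e : (fun n : ℕ => (cf u n * Complex.exp ((n : ℤ) * θ * I)
        + cf u (-(n : ℤ)) * Complex.exp ((-(n : ℤ) : ℤ) * θ * I)).re)
        = fun n : ℕ => 2 * (cf u n * circleMap 0 1 θ ^ n).re := by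
      funext n
      have : cf u (-(n : ℤ)) * Complex.exp ((-(n : ℤ) : ℤ) * θ * I)
          = (starRingEnd ℂ) (cf u n * circleMap 0 1 θ ^ n) := by
        rw [cf_conj, map_mul, circleMap_pow_eq, ← Complex.exp_conj]
        congr 2
        simp
      rw [this, circleMap_pow_eq, Complex.add_re, Complex.conj_re]
      ring
    rw [e] at h3
    have h5 := h3.unique h4
    simp only [bd, Complex.sub_re, Complex.mul_re]
    simp at h5 ⊢
    rw [← h5]
    simp [hu]
  · simp only [powSum]
    rw [tsum_eq_single 0 (fun n hn => by simp [hn])]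
    simp [h0]

/-- A holomorphic disk with absolutely summable Fourier coefficients is the sum of its
Fourier series. -/
theorem HolDisk.eqOn_powSum {f : ℂ → ℂ} (hf : HolDisk f)
    (hs : Summable fun n => ‖cf (bd f) n‖) :
    EqOn f (powSum fun n => cf (bd f) n) (closedBall 0 1) := by
  have ha : Summable fun n : ℕ => ‖cf (bd f) n‖ := hs.comp_injective Nat.cast_injective
  have hneg : ∀ n : ℕ, cf (bd f) (-((n : ℤ) + 1)) = 0 := fun n => by
    have h1 := (hf.pow_mul (n + 1)).integral_bd
    simp only [bd, circleMap_pow_eq] at h1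
    simp only [cf]
    have e : ∀ θ : ℝ, Complex.exp (-((-((n : ℤ) + 1) : ℤ) * θ * I)) * bd f θ
        = Complex.exp (((n + 1 : ℕ) : ℤ) * θ * I) * f (circleMap 0 1 θ) := fun θ => by
      simp only [bd]
      congr 2
      push_cast
      ring
    simp only [e, h1]
    simp
  have hbd : ∀ θ, f (circleMap 0 1 θ) = powSum (fun n => cf (bd f) n) (circleMap 0 1 θ) := by
    intro θ
    have h1 := hasSum_cf hf.continuous_bd (bd_periodic f) hs.of_norm θ
    have h2 := hasSum_powSum ha (circleMap_mem_closedBall_one θ)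
    simp only [circleMap_pow_eq] at h2
    have h3 := HasSum.of_nat_of_neg_add_one (f := fun n : ℤ => cf (bd f) n * Complex.exp (n * θ * I))
      h2 (m' := 0) (by simpa only [hneg, zero_mul] using hasSum_zero)
    rw [add_zero] at h3
    exact h1.unique h3
  have := Complex.eqOn_closure_of_eqOn_frontier (U := ball (0 : ℂ) 1) isBounded_ball
    (holDisk_iff.1 hf) (holDisk_iff.1 (holDisk_powSum ha)) (fun z hz => by
      rw [frontier_ball _ one_ne_zero, ← abs_one, ← range_circleMap] at hz
      obtain ⟨θ, rfl⟩ := hz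
      exact hbd θ)
  rwa [closure_ball _ one_ne_zero] at this

theorem HolDisk.norm_le_of_bd {f : ℂ → ℂ} (hf : HolDisk f) {C : ℝ} (hC : ∀ θ, ‖bd f θ‖ ≤ C)
    {z : ℂ} (hz : z ∈ closedBall (0 : ℂ) 1) : ‖f z‖ ≤ C := by
  refine Complex.norm_le_of_forall_mem_frontier_norm_le (U := ball (0 : ℂ) 1) isBounded_ball
    (holDisk_iff.1 hf) (fun z hz => ?_) (by rwa [closure_ball _ one_ne_zero])
  rw [frontier_ball _ one_ne_zero, ← abs_one, ← range_circleMap] at hz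
  obtain ⟨θ, rfl⟩ := hz
  exact hC θ

/-- If the Taylor coefficients of a disk are summable against `n`, its derivative extends
continuously to the closed disk. -/
theorem hasDerivAt_powSum {a : ℕ → ℂ} (ha : Summable fun n : ℕ => (n : ℝ) * ‖a n‖) :
    (Summable fun n : ℕ => ‖((n : ℂ) + 1) * a (n + 1)‖) ∧
    ∀ z ∈ ball (0 : ℂ) 1,
      HasDerivAt (powSum a) (powSum (fun n : ℕ => ((n : ℂ) + 1) * a (n + 1)) z) z := by
  have h1 : Summable fun n : ℕ => ‖((n : ℂ) + 1) * a (n + 1)‖ := by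
    have := (summable_nat_add_iff 1).2 ha
    refine this.congr fun n => ?_
    rw [norm_mul]
    congr 1
    exact_mod_cast (Complex.norm_natCast (n + 1)).symm
  refine ⟨h1, fun z hz => ?_⟩
  have h2 := hasDerivAt_tsum_of_isPreconnected (u := fun n : ℕ => (n : ℝ) * ‖a n‖)
    (g := fun (n : ℕ) z => a n * z ^ n) (g' := fun (n : ℕ) z => a n * (n * z ^ (n - 1))) ha isOpen_ball
    (convex_ball (0 : ℂ) 1).isPreconnected (fun n y _ => (hasDerivAt_pow n y).const_mul (a n))
    (fun n y hy => by
      rw [norm_mul, norm_mul, norm_pow, Complex.norm_natCast, mul_comm, mul_assoc]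
      have hy : ‖y‖ ≤ 1 := by simpa using (mem_ball_zero_iff.1 hy).le
      have : ‖y‖ ^ (n - 1) ≤ 1 := pow_le_one₀ (norm_nonneg y) hy
      have h0 := norm_nonneg (a n)
      gcongr
      exact mul_le_of_le_one_left h0 this)
    (y₀ := 0) (by simp) (by
      refine summable_of_ne_finset_zero (s := {0}) fun n hn => ?_
      simp at hn
      simp [hn]) hz
  refine h2.congr_deriv ?_
  have hsum : Summable fun n : ℕ => a n * (n * z ^ (n - 1)) := by
    refine Summable.of_norm_bounded ha fun n => ?_
    rw [norm_mul, norm_mul, norm_pow, Complex.norm_natCast, mul_comm, mul_assoc]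
    have hy : ‖z‖ ≤ 1 := by simpa using (mem_ball_zero_iff.1 hz).le
    have : ‖z‖ ^ (n - 1) ≤ 1 := pow_le_one₀ (norm_nonneg z) hy
    have h0 := norm_nonneg (a n)
    gcongr
    exact mul_le_of_le_one_left h0 this
  rw [hsum.tsum_eq_zero_add, powSum]
  simp only [Nat.cast_zero, zero_mul, mul_zero, zero_add, Nat.add_sub_cancel]
  refine tsum_congr fun n => ?_
  push_cast
  ring

end HolomorphicDisks

section SobolevAlgebra

open MeasureTheory Filter Topology

/-- `u` is a continuous `2π`-periodic function with squared `H¹` norm controlled by `X`. -/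
structure H1Bound (u : ℝ → ℂ) (X : ℝ) : Prop where
  continuous : Continuous u
  periodic : Function.Periodic u (2 * Real.pi)
  transBound : TransBound u X
  energy_le : energy u ≤ X

namespace H1Bound

variable {u v : ℝ → ℂ} {X Y : ℝ}

theorem nonneg (hu : H1Bound u X) : 0 ≤ X := hu.transBound.nonneg

theorem mono (hu : H1Bound u X) (h : X ≤ Y) : H1Bound u Y :=
  ⟨hu.1, hu.2, hu.3.mono h, hu.4.trans h⟩

theorem norm_sq_le (hu : H1Bound u X) (θ : ℝ) : ‖u θ‖ ^ 2 ≤ 3 * sobolevConst * X := by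
  have h := hu.transBound.norm_sq_le hu.continuous hu.periodic one_pos le_rfl θ
  have h2 := mul_le_mul_of_nonneg_left hu.energy_le sobolevConst_nonneg
  simp only [inv_one, one_pow, mul_one, one_mul] at h
  linarith

theorem exists_bound (hu : H1Bound u X) : ∃ M, 0 ≤ M ∧ ∀ θ, ‖u θ‖ ≤ M := by
  refine ⟨√(3 * sobolevConst * X), Real.sqrt_nonneg _, fun θ => ?_⟩
  exact Real.le_sqrt_of_sq_le (hu.norm_sq_le θ)

end H1Bound

/-- The space `H¹` of the circle is an algebra. -/
theorem H1Bound.mul {u v : ℝ → ℂ} {X Y : ℝ} (hu : H1Bound u X) (hv : H1Bound v Y) :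
    H1Bound (fun θ => u θ * v θ) (12 * sobolevConst * X * Y) := by
  have hS := sobolevConst_nonneg
  have hX := hu.nonneg
  have hY := hv.nonneg
  have huc := hu.continuous
  have hvc := hv.continuous
  refine ⟨by fun_prop, fun θ => by simp only [hu.periodic θ, hv.periodic θ], fun h => ?_, ?_⟩
  · have := energy_le_of_sq_le_two (u := fun θ => u (θ + h) * v (θ + h) - u θ * v θ)
      (v₁ := fun θ => u (θ + h) - u θ) (v₂ := fun θ => v (θ + h) - v θ)
      (c₁ := 2 * (3 * sobolevConst * Y)) (c₂ := 2 * (3 * sobolevConst * X))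
      (by fun_prop) (by fun_prop) (by fun_prop) (fun θ => by
        have e : u (θ + h) * v (θ + h) - u θ * v θ
            = (u (θ + h) - u θ) * v (θ + h) + u θ * (v (θ + h) - v θ) := by ring
        have h1 := norm_add_le ((u (θ + h) - u θ) * v (θ + h)) (u θ * (v (θ + h) - v θ))
        rw [← e, norm_mul (u (θ + h) - u θ), norm_mul (u θ)] at h1
        have h2 := hu.norm_sq_le θ
        have h3 := hv.norm_sq_le (θ + h)
        have h0 := norm_nonneg (u (θ + h) * v (θ + h) - u θ * v θ)
        calc _ ≤ (‖u (θ + h) - u θ‖ * ‖v (θ + h)‖ + ‖u θ‖ * ‖v (θ + h) - v θ‖) ^ 2 := by gcongr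
          _ ≤ 2 * (‖v (θ + h)‖ ^ 2) * ‖u (θ + h) - u θ‖ ^ 2
              + 2 * (‖u θ‖ ^ 2) * ‖v (θ + h) - v θ‖ ^ 2 := by
            nlinarith [sq_nonneg (‖u (θ + h) - u θ‖ * ‖v (θ + h)‖ - ‖u θ‖ * ‖v (θ + h) - v θ‖)]
          _ ≤ _ := by gcongr)
    have h1 := hu.transBound h
    have h2 := hv.transBound h
    calc _ ≤ _ := this
      _ ≤ 2 * (3 * sobolevConst * Y) * (X * h ^ 2) + 2 * (3 * sobolevConst * X) * (Y * h ^ 2) := by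
        gcongr
      _ = _ := by ring
  · have := energy_le_of_sq_le_one (u := fun θ => u θ * v θ) (v₁ := v)
      (c₁ := 3 * sobolevConst * X) (by fun_prop) hvc (fun θ => by
        rw [norm_mul, mul_pow]
        have := hu.norm_sq_le θ
        gcongr)
    refine this.trans ?_
    have h2 : 3 * sobolevConst * X * energy v ≤ 3 * sobolevConst * X * Y := by
      have := hv.energy_le
      gcongr
    have : 0 ≤ sobolevConst * X * Y := by positivity
    linarith

theorem H1Bound.neg {u : ℝ → ℂ} {X : ℝ} (hu : H1Bound u X) : H1Bound (fun θ => -u θ) X := by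
  have hc := hu.continuous
  refine ⟨by fun_prop, fun θ => by simp only [hu.periodic θ], fun h => ?_, ?_⟩
  · refine le_trans (le_of_eq ?_) (hu.transBound h)
    simp only [energy, ← neg_sub', norm_neg]
  · simpa only [energy, norm_neg] using hu.energy_le

/-- Postcomposition with a map which is Lipschitz on bounded sets. -/
theorem H1Bound.comp {u : ℝ → ℂ} {X : ℝ} (hu : H1Bound u X) {φ : ℂ → ℂ} (hφ : Continuous φ)
    {M C : ℝ} (hM : ∀ θ, ‖u θ‖ ≤ M)
    (hC : ∀ z w : ℂ, ‖z‖ ≤ M → ‖w‖ ≤ M → ‖φ z - φ w‖ ≤ C * ‖z - w‖) :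
    ∃ Y, H1Bound (fun θ => φ (u θ)) Y := by
  have hc := hu.continuous
  have h1 : TransBound (fun θ => φ (u θ)) (C ^ 2 * X) := fun h => by
    have := energy_le_of_sq_le_one (u := fun θ => φ (u (θ + h)) - φ (u θ))
      (v₁ := fun θ => u (θ + h) - u θ) (c₁ := C ^ 2) (by fun_prop) (by fun_prop) (fun θ => by
        have h1 := hC _ _ (hM (θ + h)) (hM θ)
        have h0 := norm_nonneg (φ (u (θ + h)) - φ (u θ))
        rw [← mul_pow]
        gcongr)
    refine this.trans ?_
    have := mul_le_mul_of_nonneg_left (hu.transBound h) (sq_nonneg C)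
    linarith
  have hp : Function.Periodic (fun θ => φ (u θ)) (2 * Real.pi) :=
    fun θ => by simp only [hu.periodic θ]
  exact ⟨max (C ^ 2 * X) (energy fun θ => φ (u θ)), by fun_prop, hp,
    h1.mono (le_max_left _ _), le_max_right _ _⟩

theorem norm_exp_sub_exp_le {M : ℝ} {z w : ℂ} (hz : ‖z‖ ≤ M) (hw : ‖w‖ ≤ M) :
    ‖Complex.exp z - Complex.exp w‖ ≤ Real.exp M * ‖z - w‖ := by
  refine (convex_closedBall (0 : ℂ) M).norm_image_sub_le_of_norm_hasDerivWithin_le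
    (f' := Complex.exp) (fun x _ => (Complex.hasDerivAt_exp x).hasDerivWithinAt) (fun x hx => ?_)
    (by simpa using hw) (by simpa using hz)
  rw [Complex.norm_exp]
  gcongr
  exact (Complex.re_le_norm x).trans (by simpa using hx)

theorem H1Bound.cexp {u : ℝ → ℂ} {X : ℝ} (hu : H1Bound u X) :
    ∃ Y, H1Bound (fun θ => Complex.exp (u θ)) Y := by
  obtain ⟨M, _, hM⟩ := hu.exists_bound
  exact hu.comp Complex.continuous_exp hM fun z w hz hw => norm_exp_sub_exp_le hz hw

theorem H1Bound.of_transBound {u : ℝ → ℂ} {K : ℝ} (hc : Continuous u)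
    (hp : Function.Periodic u (2 * Real.pi)) (hK : TransBound u K) : ∃ X, H1Bound u X :=
  ⟨max K (energy u), hc, hp, hK.mono (le_max_left _ _), le_max_right _ _⟩

theorem H1Bound.re_sub_re {u v : ℝ → ℂ} {X Y : ℝ} (hu : H1Bound u X) (hv : H1Bound v Y) :
    ∃ Z, H1Bound (fun θ => (((u θ).re - (v θ).re : ℝ) : ℂ)) Z := by
  have huc := hu.continuous
  have hvc := hv.continuous
  have : TransBound (fun θ => (((u θ).re - (v θ).re : ℝ) : ℂ)) (2 * X + 2 * Y) := fun h => by
    have h1 := energy_le_of_sq_le_two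
      (u := fun θ => (((u (θ + h)).re - (v (θ + h)).re : ℝ) : ℂ) - (((u θ).re - (v θ).re : ℝ) : ℂ))
      (v₁ := fun θ => u (θ + h) - u θ) (v₂ := fun θ => v (θ + h) - v θ) (c₁ := 2) (c₂ := 2)
      (by fun_prop) (by fun_prop) (by fun_prop) (fun θ => by
        rw [← ofReal_sub, Complex.norm_real, Real.norm_eq_abs, sq_abs]
        have h1 := pow_le_pow_left₀ (abs_nonneg _) (abs_re_le_norm (u (θ + h) - u θ)) 2
        have h2 := pow_le_pow_left₀ (abs_nonneg _) (abs_re_le_norm (v (θ + h) - v θ)) 2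
        rw [sq_abs, sub_re] at h1 h2
        nlinarith [sq_nonneg ((u (θ + h)).re - (u θ).re + ((v (θ + h)).re - (v θ).re))])
    have h2 := hu.transBound h
    have h3 := hv.transBound h
    refine h1.trans ?_
    linarith
  exact H1Bound.of_transBound (by fun_prop)
    (fun θ => by simp only [hv.periodic θ, hu.periodic θ]) this

end SobolevAlgebra

section RiemannHilbert

open MeasureTheory Filter Topology

/-- Every `H¹` function on the circle has the same argument as a holomorphic disk: there is a
disk `Q` with `Im Q = Im Λ` on the circle. -/
theorem exists_integrating_factor {Λ : ℝ → ℂ} {X : ℝ} (hΛ : H1Bound Λ X) :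
    ∃ Q : ℂ → ℂ, HolDisk Q ∧ (∃ Y, H1Bound (bd Q) Y) ∧ ∃ m : ℝ → ℝ,
      (∃ Y, H1Bound (fun θ => (m θ : ℂ)) Y) ∧
      ∀ θ, Complex.exp (bd Q θ) = Real.exp (m θ) * Complex.exp (Λ θ) := by
  have hc := hΛ.continuous
  have him : ∀ φ : ℂ → ℂ, Continuous φ → (∀ z w, ‖φ z - φ w‖ ≤ 1 * ‖z - w‖) →
      ∃ Y, H1Bound (fun θ => φ (Λ θ)) Y := fun φ h1 h2 => by
    obtain ⟨M, _, hM⟩ := hΛ.exists_bound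
    exact hΛ.comp h1 hM fun z w _ _ => h2 z w
  obtain ⟨Y, hY⟩ := him (fun z => (z.im : ℂ)) (by fun_prop) fun z w => by
    rw [← ofReal_sub, ← sub_im, Complex.norm_real, one_mul]
    exact Complex.abs_im_le_norm _
  obtain ⟨f, hf, hfre, -⟩ := exists_holDisk_re (b := fun θ => (Λ θ).im) (K := Y) (by fun_prop)
    (fun θ => by simp only [hΛ.periodic θ]) (fun h => by
      have := hY.transBound h
      simpa only [energy, ← ofReal_sub, Complex.norm_real] using this)
  have hft : TransBound (bd f) (2 * Y) := hf.transBound (fun h => by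
      have := hY.transBound h
      simpa only [energy, ← ofReal_sub, Complex.norm_real, hfre] using this)
  obtain ⟨Z, hZ⟩ := H1Bound.of_transBound hf.continuous_bd (bd_periodic f) hft
  have hQt : TransBound (bd fun z => I * f z) Z := fun h => by
    have := hZ.transBound h
    simpa only [bd, energy, ← mul_sub, norm_mul, Complex.norm_I, one_mul] using this
  have hQ := hf.const_mul I
  obtain ⟨W, hW⟩ := H1Bound.of_transBound hQ.continuous_bd (bd_periodic _) hQt
  refine ⟨_, hQ, ⟨W, hW⟩, fun θ => (bd (fun z => I * f z) θ).re - (Λ θ).re, ?_, fun θ => ?_⟩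
  · exact hW.re_sub_re hΛ
  · have h1 := hfre θ
    rw [ofReal_exp, ← Complex.exp_add]
    congr 1
    apply Complex.ext
    · simp
    · simp [bd] at h1 ⊢
      exact h1

/-- A priori estimate for the Riemann–Hilbert problem `Re (e^Λ D) = B`. -/
theorem exists_apriori_bound {Λ : ℝ → ℂ} {X : ℝ} (hΛ : H1Bound Λ X) :
    ∃ C, 0 < C ∧ ∀ (D : ℂ → ℂ) (B : ℝ → ℝ) (Y K : ℝ), HolDisk D →
      (∀ θ, (Complex.exp (Λ θ) * bd D θ).re = B θ) → H1Bound (fun θ => (B θ : ℂ)) K →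
      energy (bd D) ≤ Y → H1Bound (bd D) (C * (K + Y)) := by
  obtain ⟨Q, hQ, ⟨X₁, hX₁⟩, m, ⟨X₂, hX₂⟩, hm⟩ := exists_integrating_factor hΛ
  obtain ⟨X₃, hX₃⟩ := hX₁.cexp
  obtain ⟨X₄, hX₄⟩ := hX₁.neg.cexp
  obtain ⟨X₅, hX₅⟩ := hX₂.cexp
  have hS := sobolevConst_nonneg
  have h3 := hX₃.nonneg
  have h4 := hX₄.nonneg
  have h5 := hX₅.nonneg
  set S := sobolevConst
  refine ⟨12 * S * X₄ * (24 * S * X₅ + 3 * S * X₃) + 1, by positivity,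
    fun D B Y K hD hB hK hY => ?_⟩
  have hY0 := (energy_nonneg _).trans hY
  have hK0 := hK.nonneg
  have hDc := hD.continuous_bd
  have hQc := hQ.continuous_bd
  have hP := hQ.cexp.mul hD
  have hre : ∀ θ, (bd (fun z => Complex.exp (Q z) * D z) θ).re = Real.exp (m θ) * B θ := fun θ => by
    rw [← hB θ, ← Complex.re_ofReal_mul, ← mul_assoc, ← hm θ]
    rfl
  have h6 := hX₅.mul hK
  have h7 : TransBound (bd fun z => Complex.exp (Q z) * D z) (2 * (12 * S * X₅ * K)) := by
    refine hP.transBound fun h => ?_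
    have := h6.transBound h
    simpa only [energy, ← ofReal_exp, ← ofReal_mul, ← ofReal_sub, Complex.norm_real, hre] using this
  have h8 : energy (bd fun z => Complex.exp (Q z) * D z) ≤ 3 * S * X₃ * Y := by
    have := energy_le_of_sq_le_one (u := bd fun z => Complex.exp (Q z) * D z) (v₁ := bd D)
      (c₁ := 3 * S * X₃) hP.continuous_bd hDc (fun θ => by
        have := hX₃.norm_sq_le θ
        simp only [bd, norm_mul, mul_pow] at this ⊢
        gcongr)
    refine this.trans ?_
    gcongr
  have h9 : H1Bound (bd fun z => Complex.exp (Q z) * D z)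
      ((24 * S * X₅ + 3 * S * X₃) * (K + Y)) := by
    have e : (24 * S * X₅ + 3 * S * X₃) * (K + Y)
      = 2 * (12 * S * X₅ * K) + 3 * S * X₃ * Y + (24 * S * X₅ * Y + 3 * S * X₃ * K) := by ring
    refine ⟨hP.continuous_bd, bd_periodic _, h7.mono ?_, h8.trans ?_⟩
    · rw [e]
      have : 0 ≤ 3 * S * X₃ * Y + (24 * S * X₅ * Y + 3 * S * X₃ * K) := by positivity
      linarith
    · rw [e]
      have : 0 ≤ 2 * (12 * S * X₅ * K) + (24 * S * X₅ * Y + 3 * S * X₃ * K) := by positivity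
      linarith
  have h10 := hX₄.mul h9
  have e : (fun θ => Complex.exp (-bd Q θ) * bd (fun z => Complex.exp (Q z) * D z) θ) = bd D := by
    funext θ
    simp only [bd, ← mul_assoc, ← Complex.exp_add]
    simp
  rw [e] at h10
  refine h10.mono ?_
  have : 0 ≤ K + Y := by positivity
  linarith

/-- A bounded linear solution operator for the Riemann–Hilbert problem `Re (e^Λ D) = b`. -/
theorem exists_riemannHilbert {Λ : ℝ → ℂ} {X : ℝ} (hΛ : H1Bound Λ X) :
    ∃ C, 0 < C ∧ ∃ L : (ℝ → ℝ) → ℂ → ℂ,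
      (∀ b K, H1Bound (fun θ => (b θ : ℂ)) K →
        HolDisk (L b) ∧ (∀ θ, (Complex.exp (Λ θ) * bd (L b) θ).re = b θ) ∧
        H1Bound (bd (L b)) (C * K)) ∧
      ∀ b₁ b₂ K₁ K₂, H1Bound (fun θ => (b₁ θ : ℂ)) K₁ → H1Bound (fun θ => (b₂ θ : ℂ)) K₂ →
        energy (fun θ => bd (L b₁) θ - bd (L b₂) θ) ≤ C * energy (fun θ => b₁ θ - b₂ θ) := by
  classical
  obtain ⟨Q, hQ, ⟨X₁, hX₁⟩, m, ⟨X₂, hX₂⟩, hm⟩ := exists_integrating_factor hΛ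
  obtain ⟨X₄, hX₄⟩ := hX₁.neg.cexp
  obtain ⟨X₅, hX₅⟩ := hX₂.cexp
  have hS := sobolevConst_nonneg
  have h4 := hX₄.nonneg
  have h5 := hX₅.nonneg
  set S := sobolevConst
  have key : ∀ b : ℝ → ℝ, ∃ f : ℂ → ℂ, ∀ K, H1Bound (fun θ => (b θ : ℂ)) K →
      HolDisk f ∧ (∀ θ, (bd f θ).re = Real.exp (m θ) * b θ) ∧ (f 0).im = 0 := fun b => by
    by_cases hb : ∃ K, H1Bound (fun θ => (b θ : ℂ)) K
    · obtain ⟨K, hK⟩ := hb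
      have h6 := hX₅.mul hK
      obtain ⟨f, h1, h2, h3⟩ := exists_holDisk_re (b := fun θ => Real.exp (m θ) * b θ)
        (K := 12 * S * X₅ * K)
        (by
          have := Complex.continuous_re.comp h6.continuous
          refine this.congr fun θ => ?_
          simp [← ofReal_exp])
        (fun θ => by
          have := h6.periodic θ
          simp only [← ofReal_exp, ← ofReal_mul] at this
          exact_mod_cast this)
        (fun h => by
          have := h6.transBound h
          simpa only [energy, ← ofReal_exp, ← ofReal_mul, ← ofReal_sub, Complex.norm_real] using this)
      exact ⟨f, fun _ _ => ⟨h1, h2, h3⟩⟩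
    · exact ⟨0, fun K hK => absurd ⟨K, hK⟩ hb⟩
  choose f hf using key
  have hL : ∀ b K, H1Bound (fun θ => (b θ : ℂ)) K →
      HolDisk (fun z => Complex.exp (-Q z) * f b z) := fun b K hK =>
    hQ.neg.cexp.mul (hf b K hK).1
  set C₁ := 12 * S * X₄ * (2 * (12 * S * X₅))
  set C₂ := 3 * S * X₄ * (2 * (3 * S * X₅))
  have hC₁ : 0 ≤ C₁ := by positivity
  have hC₂ : 0 ≤ C₂ := by positivity
  refine ⟨C₁ + C₂ + 1, by positivity, fun b z => Complex.exp (-Q z) * f b z,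
    fun b K hK => ⟨hL b K hK, fun θ => ?_, ?_⟩, fun b₁ b₂ K₁ K₂ hK₁ hK₂ => ?_⟩
  · have h1 := (hf b K hK).2.1 θ
    have h2 := hm θ
    have e : Complex.exp (Λ θ) = (Real.exp (-m θ) : ℝ) * Complex.exp (bd Q θ) := by
      rw [h2, ← mul_assoc, ← ofReal_mul, ← Real.exp_add]
      simp
    have e2 : Complex.exp (Λ θ) * bd (fun z => Complex.exp (-Q z) * f b z) θ
        = (Real.exp (-m θ) : ℝ) * bd (f b) θ := by
      rw [e]
      simp only [bd]
      rw [mul_assoc, ← mul_assoc (Complex.exp (Q _)), ← Complex.exp_add]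
      simp
    rw [e2, Complex.re_ofReal_mul, h1, ← mul_assoc, ← Real.exp_add]
    simp
  · obtain ⟨h1, h2, h3⟩ := hf b K hK
    have h6 := hX₅.mul hK
    have hK0 := hK.nonneg
    have h7 : H1Bound (bd (f b)) (2 * (12 * S * X₅ * K)) := by
      refine ⟨h1.continuous_bd, bd_periodic _, h1.transBound fun h => ?_,
        (h1.energy_le h3).trans ?_⟩
      · have := h6.transBound h
        simpa only [energy, ← ofReal_exp, ← ofReal_mul, ← ofReal_sub, Complex.norm_real, h2] using this
      · have := h6.energy_le
        simp only [energy, ← ofReal_exp, ← ofReal_mul, Complex.norm_real, h2] at this ⊢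
        linarith
    refine (hX₄.mul h7).mono ?_
    have : 12 * S * X₄ * (2 * (12 * S * X₅ * K)) = C₁ * K := by simp only [C₁]; ring
    rw [this]
    gcongr
    linarith
  · obtain ⟨h1, h2, h3⟩ := hf b₁ K₁ hK₁
    obtain ⟨h1', h2', h3'⟩ := hf b₂ K₂ hK₂
    have hb₁ : Continuous b₁ := (Complex.continuous_re.comp hK₁.continuous).congr fun θ => by simp
    have hb₂ : Continuous b₂ := (Complex.continuous_re.comp hK₂.continuous).congr fun θ => by simp
    have hc := h1.continuous_bd
    have hc' := h1'.continuous_bd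
    have hsub := (h1.sub h1').energy_le (by simp [h3, h3'])
    have e1 := energy_le_of_sq_le_one (u := fun θ => bd (fun z => Complex.exp (-Q z) * f b₁ z) θ
        - bd (fun z => Complex.exp (-Q z) * f b₂ z) θ)
      (v₁ := bd fun z => f b₁ z - f b₂ z) (c₁ := 3 * S * X₄)
      ((hL b₁ K₁ hK₁).continuous_bd.sub (hL b₂ K₂ hK₂).continuous_bd)
      (h1.sub h1').continuous_bd (fun θ => by
        have := hX₄.norm_sq_le θ
        simp only [bd, ← mul_sub, norm_mul, mul_pow] at this ⊢
        gcongr)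
    have e2 := energy_le_of_sq_le_one (u := fun θ => (bd (fun z => f b₁ z - f b₂ z) θ).re)
      (v₁ := fun θ => b₁ θ - b₂ θ) (c₁ := 3 * S * X₅)
      (Complex.continuous_re.comp (h1.sub h1').continuous_bd) (by fun_prop) (fun θ => by
        have := hX₅.norm_sq_le θ
        rw [← ofReal_exp, Complex.norm_real] at this
        have e : (bd (fun z => f b₁ z - f b₂ z) θ).re = Real.exp (m θ) * (b₁ θ - b₂ θ) := by
          rw [mul_sub, ← h2, ← h2']
          simp [bd]
        rw [e, norm_mul, mul_pow]
        gcongr)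
    have hnn := energy_nonneg (fun θ => b₁ θ - b₂ θ)
    calc _ ≤ _ := e1
      _ ≤ 3 * S * X₄ * (2 * (3 * S * X₅ * energy fun θ => b₁ θ - b₂ θ)) := by
        gcongr
        exact hsub.trans (by linarith)
      _ = C₂ * energy fun θ => b₁ θ - b₂ θ := by simp only [C₂]; ring
      _ ≤ _ := by
        gcongr
        linarith

end RiemannHilbert

section SmallSolutions

open MeasureTheory Filter Topology

/-- Holomorphic disks with translation bound `1` and energy at most `e`. -/
structure SmallDisk (e : ℝ) (f : ℂ → ℂ) : Prop where
  holDisk : HolDisk f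
  transBound : TransBound (bd f) 1
  energy_le : energy (bd f) ≤ e

/-- Small disks which are close in energy are uniformly close. -/
theorem SmallDisk.exists_close {e ε : ℝ} (hε : 0 < ε) :
    ∃ η, 0 < η ∧ ∀ f g, SmallDisk e f → SmallDisk e g →
      energy (fun θ => bd f θ - bd g θ) ≤ η → ∀ z ∈ closedBall (0 : ℂ) 1, ‖f z - g z‖ ≤ ε := by
  have hS := sobolevConst_nonneg
  set S := sobolevConst
  obtain ⟨μ, hμ, hμ1, hμ2⟩ : ∃ μ, 0 < μ ∧ μ ≤ 1 ∧ S * μ * 4 ≤ ε ^ 2 / 2 := by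
    refine ⟨min 1 (ε ^ 2 / (8 * (S + 1))), by positivity, min_le_left _ _, ?_⟩
    calc S * min 1 (ε ^ 2 / (8 * (S + 1))) * 4 ≤ (S + 1) * (ε ^ 2 / (8 * (S + 1))) * 4 := by
          gcongr
          · linarith
          · exact min_le_right _ _
      _ = ε ^ 2 / 2 := by field_simp; norm_num
  refine ⟨ε ^ 2 * μ ^ 3 / (4 * (S + 1)), by positivity, fun f g hf hg hfg z hz => ?_⟩
  have hfc := hf.holDisk.continuous_bd
  have hgc := hg.holDisk.continuous_bd
  refine (hf.holDisk.sub hg.holDisk).norm_le_of_bd (fun θ => ?_) hz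
  have ht : TransBound (fun θ => bd f θ - bd g θ) 4 := fun h => by
    have e : (fun θ => bd f (θ + h) - bd g (θ + h) - (bd f θ - bd g θ))
        = fun θ => (bd f (θ + h) - bd f θ) - (bd g (θ + h) - bd g θ) := by
      funext θ
      ring
    rw [e]
    have h1 := energy_le_sub (u := fun θ => bd f (θ + h) - bd f θ)
      (v := fun θ => bd g (θ + h) - bd g θ) (by fun_prop) (by fun_prop)
    have h2 := hf.transBound h
    have h3 := hg.transBound h
    linarith
  have h1 := ht.norm_sq_le (by fun_prop)
    (fun θ => by simp only [bd_periodic f θ, bd_periodic g θ]) hμ hμ1 θ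
  have h2 : S * (μ * 4 + 2 * μ⁻¹ ^ 3 * energy fun θ => bd f θ - bd g θ) ≤ ε ^ 2 := by
    have : S * (2 * μ⁻¹ ^ 3 * energy fun θ => bd f θ - bd g θ)
        ≤ (S + 1) * (2 * μ⁻¹ ^ 3 * (ε ^ 2 * μ ^ 3 / (4 * (S + 1)))) := by
      have := energy_nonneg fun θ => bd f θ - bd g θ
      gcongr
      linarith
    have e2 : (S + 1) * (2 * μ⁻¹ ^ 3 * (ε ^ 2 * μ ^ 3 / (4 * (S + 1)))) = ε ^ 2 / 2 := by
      field_simp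
      norm_num
    linarith
  exact abs_le_of_sq_le_sq' (h1.trans h2) hε.le |>.2

/-- Small solutions of the nonlinear Riemann–Hilbert problem `Re (e^Λ v) = s - N(θ, v)`, with `N`
quadratically small in `v`, obtained by iteration. -/
theorem exists_small_solutions {W : Type*} [NormedAddCommGroup W] {Λ : ℝ → ℂ} {X : ℝ}
    (hΛ : H1Bound Λ X) {N : ℝ → ℂ → ℝ} (hNc : Continuous fun p : ℝ × ℂ => N p.1 p.2)
    (hNp : ∀ θ v, N (θ + 2 * Real.pi) v = N θ v) (hN0 : ∀ θ, N θ 0 = 0) {q : ℝ → W} {K C : ℝ}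
    (hq : Continuous q) (hqK : TransBound q K)
    (hN : ∀ θ θ' v v', ‖v‖ ≤ 1 → ‖v'‖ ≤ 1 →
      |N θ' v' - N θ v| ≤ C * (‖v‖ + ‖v'‖) * (‖q θ' - q θ‖ + ‖v' - v‖)) :
    ∃ δ, 0 < δ ∧ ∃ v : ℝ → ℂ → ℂ,
      (∀ s, |s| < δ → HolDisk (v s) ∧ TransBound (bd (v s)) 1 ∧ (∀ θ, ‖bd (v s) θ‖ ≤ 1) ∧
        ∀ θ, (Complex.exp (Λ θ) * bd (v s) θ).re = s - N θ (bd (v s) θ)) ∧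
      ContinuousOn (fun p : ℂ × ℝ => v p.2 p.1) (closedBall 0 1 ×ˢ Ioo (-δ) δ) ∧
      ∀ z ∈ closedBall (0 : ℂ) 1, v 0 z = 0 := by
  obtain ⟨A, hA, L, hL1, hL2⟩ := exists_riemannHilbert hΛ
  have hS := sobolevConst_nonneg
  have hK := hqK.nonneg
  -- the size of the disks in the uniform norm
  set s₀ : ℝ := 1 / (1 + 8 * C ^ 2 * (K + 1) * A + 32 * C ^ 2 * A) with hs₀
  have hs₀pos : 0 < s₀ := by positivity
  have hden : s₀ * (1 + 8 * C ^ 2 * (K + 1) * A + 32 * C ^ 2 * A) = 1 := by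
    rw [hs₀]; field_simp
  have hs₀1 : s₀ ≤ 1 := by
    have : 0 ≤ s₀ * (8 * C ^ 2 * (K + 1) * A + 32 * C ^ 2 * A) := by positivity
    nlinarith
  have hs₀2 : 8 * C ^ 2 * s₀ * (K + 1) ≤ 1 / A := by
    rw [le_div_iff₀ hA]
    have : 0 ≤ s₀ * (1 + 32 * C ^ 2 * A) := by positivity
    nlinarith
  have hs₀3 : 8 * C ^ 2 * s₀ * A ≤ 1 / 4 := by
    have : 0 ≤ s₀ * (1 + 8 * C ^ 2 * (K + 1) * A) := by positivity
    nlinarith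
  obtain ⟨e, he, he1, hsup⟩ : ∃ e, 0 < e ∧ e ≤ 1 ∧
      ∀ f, SmallDisk e f → ∀ θ, ‖bd f θ‖ ^ 2 ≤ s₀ := by
    set S := sobolevConst
    obtain ⟨μ, hμ, hμ1, hμ2⟩ : ∃ μ, 0 < μ ∧ μ ≤ 1 ∧ S * μ ≤ s₀ / 2 := by
      refine ⟨min 1 (s₀ / (2 * (S + 1))), by positivity, min_le_left _ _, ?_⟩
      calc S * min 1 (s₀ / (2 * (S + 1))) ≤ (S + 1) * (s₀ / (2 * (S + 1))) := by
            gcongr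
            · linarith
            · exact min_le_right _ _
        _ = s₀ / 2 := by field_simp
    refine ⟨min 1 (s₀ * μ ^ 3 / (4 * (S + 1))), by positivity, min_le_left _ _, fun f hf θ => ?_⟩
    have h1 := hf.transBound.norm_sq_le hf.holDisk.continuous_bd (bd_periodic f) hμ hμ1 θ
    have h2 : S * (2 * μ⁻¹ ^ 3 * energy (bd f))
        ≤ (S + 1) * (2 * μ⁻¹ ^ 3 * (s₀ * μ ^ 3 / (4 * (S + 1)))) := by
      have := energy_nonneg (bd f)
      have := hf.energy_le.trans (min_le_right _ _)
      gcongr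
      linarith
    have e2 : (S + 1) * (2 * μ⁻¹ ^ 3 * (s₀ * μ ^ 3 / (4 * (S + 1)))) = s₀ / 2 := by
      field_simp
      norm_num
    linarith
  have hsup1 : ∀ f, SmallDisk e f → ∀ θ, ‖bd f θ‖ ≤ √s₀ := fun f hf θ =>
    Real.le_sqrt_of_sq_le (hsup f hf θ)
  have hsq1 : √s₀ ≤ 1 := Real.sqrt_le_one.2 hs₀1
  have hNle : ∀ f g, SmallDisk e f → SmallDisk e g → ∀ θ θ',
      |N θ' (bd g θ') - N θ (bd f θ)| ^ 2
        ≤ 8 * C ^ 2 * s₀ * ‖q θ' - q θ‖ ^ 2 + 8 * C ^ 2 * s₀ * ‖bd g θ' - bd f θ‖ ^ 2 := by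
    intro f g hf hg θ θ'
    have h1 := hN θ θ' _ _ ((hsup1 f hf θ).trans hsq1) ((hsup1 g hg θ').trans hsq1)
    have h2 := hsup1 f hf θ
    have h3 := hsup1 g hg θ'
    calc |N θ' (bd g θ') - N θ (bd f θ)| ^ 2
        ≤ (C * (‖bd f θ‖ + ‖bd g θ'‖) * (‖q θ' - q θ‖ + ‖bd g θ' - bd f θ‖)) ^ 2 := by gcongr
      _ = C ^ 2 * (‖bd f θ‖ + ‖bd g θ'‖) ^ 2 * (‖q θ' - q θ‖ + ‖bd g θ' - bd f θ‖) ^ 2 := by ring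
      _ ≤ C ^ 2 * (√s₀ + √s₀) ^ 2 * (2 * (‖q θ' - q θ‖ ^ 2 + ‖bd g θ' - bd f θ‖ ^ 2)) := by
        gcongr
        nlinarith [sq_nonneg (‖q θ' - q θ‖ - ‖bd g θ' - bd f θ‖)]
      _ = C ^ 2 * (4 * √s₀ ^ 2) * (2 * (‖q θ' - q θ‖ ^ 2 + ‖bd g θ' - bd f θ‖ ^ 2)) := by ring
      _ = _ := by rw [Real.sq_sqrt hs₀pos.le]; ring
  have hNcomp : ∀ f, SmallDisk e f → Continuous fun θ => N θ (bd f θ) := fun f hf =>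
    hNc.comp (continuous_id.prodMk hf.holDisk.continuous_bd)
  have hNen : ∀ f g, SmallDisk e f → SmallDisk e g → ∀ s s' : ℝ,
      energy (fun θ => (s - N θ (bd f θ)) - (s' - N θ (bd g θ)))
        ≤ 4 * Real.pi * (s - s') ^ 2
          + 16 * C ^ 2 * s₀ * energy (fun θ => bd f θ - bd g θ) := by
    intro f g hf hg s s'
    have h1 := hNcomp f hf
    have h2 := hNcomp g hg
    have h3 := hf.holDisk.continuous_bd
    have h4 := hg.holDisk.continuous_bd
    have := energy_le_of_sq_le_two (u := fun θ => (s - N θ (bd f θ)) - (s' - N θ (bd g θ)))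
      (v₁ := fun _ : ℝ => s - s') (v₂ := fun θ => bd f θ - bd g θ) (c₁ := 2)
      (c₂ := 16 * C ^ 2 * s₀) (by fun_prop) (by fun_prop) (by fun_prop) (fun θ => by
        have h := hNle g f hg hf θ θ
        simp only [sub_self, norm_zero, ne_eq, OfNat.ofNat_ne_zero, not_false_eq_true, zero_pow,
          mul_zero, zero_add, sq_abs] at h
        simp only [Real.norm_eq_abs, sq_abs]
        nlinarith [sq_nonneg ((s - s') + (N θ (bd f θ) - N θ (bd g θ)))])
    rw [energy_const, Real.norm_eq_abs, sq_abs] at this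
    linarith
  -- the zero disk
  have hzero : SmallDisk e 0 := by
    have h0 : bd 0 = fun _ => 0 := rfl
    refine ⟨HolDisk.const 0, fun h => ?_, ?_⟩
    · simp only [h0, sub_self, energy_const]
      simp
      positivity
    · simp only [h0, energy_const]
      simpa using he.le
  have hL0 : ∀ θ, bd (L fun _ => 0) θ = 0 := fun θ => by
    have h0 : H1Bound (fun θ => (((fun _ => 0 : ℝ → ℝ) θ : ℝ) : ℂ)) 0 := by
      refine ⟨by fun_prop, fun θ => rfl, fun h => ?_, ?_⟩
      · simp [energy]
      · simp [energy]
    have h1 := (hL1 _ _ h0).2.2.norm_sq_le θ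
    simp only [mul_zero] at h1
    exact norm_eq_zero.1 (pow_eq_zero_iff two_ne_zero |>.1 (le_antisymm h1 (sq_nonneg _)))
  have h0b : H1Bound (fun θ => (((fun _ => 0 : ℝ → ℝ) θ : ℝ) : ℂ)) 0 := by
    refine ⟨by fun_prop, fun θ => rfl, fun h => ?_, ?_⟩ <;> simp [energy]
  obtain ⟨δ, hδ, hδ2⟩ : ∃ δ, 0 < δ ∧ 4 * Real.pi * A * δ ^ 2 ≤ e / 2 := by
    have hpi := Real.pi_pos
    refine ⟨√(e / (8 * Real.pi * A)), by positivity, ?_⟩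
    rw [Real.sq_sqrt (by positivity)]
    apply le_of_eq
    field_simp
    norm_num
  set T : ℝ → (ℂ → ℂ) → ℂ → ℂ := fun s f => L fun θ => s - N θ (bd f θ) with hT
  have hb0 : ∀ f, SmallDisk e f → ∀ s : ℝ, |s| < δ →
      A * energy (fun θ => (s - N θ (bd f θ))) ≤ e := by
    intro f hf s hs
    have h1 := hNen f 0 hf hzero s 0
    have h0 : bd 0 = fun _ => 0 := rfl
    simp only [h0, hN0, sub_zero] at h1
    have h2 : s ^ 2 ≤ δ ^ 2 := by
      rw [← sq_abs]
      gcongr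
    have h3 := hf.energy_le
    have h4 := energy_nonneg (bd f)
    calc A * energy (fun θ => (s - N θ (bd f θ)))
        ≤ A * (4 * Real.pi * s ^ 2 + 16 * C ^ 2 * s₀ * energy fun θ => bd f θ) := by gcongr
      _ = 4 * Real.pi * A * s ^ 2 + 2 * (8 * C ^ 2 * s₀ * A) * energy (bd f) := by ring
      _ ≤ 4 * Real.pi * A * δ ^ 2 + 2 * (1 / 4) * e := by
        have := Real.pi_pos
        gcongr
      _ ≤ e := by linarith
  have hbH : ∀ f, SmallDisk e f → ∀ s : ℝ, |s| < δ →
      H1Bound (fun θ => ((s - N θ (bd f θ) : ℝ) : ℂ)) (1 / A) := by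
    intro f hf s hs
    have hc := hNcomp f hf
    have hfc := hf.holDisk.continuous_bd
    refine ⟨by fun_prop, fun θ => by simp only [hNp, bd_periodic f θ], fun h => ?_, ?_⟩
    · have h1 := energy_le_of_sq_le_two
        (u := fun θ => ((s - N (θ + h) (bd f (θ + h)) : ℝ) : ℂ) - ((s - N θ (bd f θ) : ℝ) : ℂ))
        (v₁ := fun θ => q (θ + h) - q θ) (v₂ := fun θ => bd f (θ + h) - bd f θ)
        (c₁ := 8 * C ^ 2 * s₀) (c₂ := 8 * C ^ 2 * s₀)
        (by fun_prop) (by fun_prop) (by fun_prop) (fun θ => by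
          have := hNle f f hf hf θ (θ + h)
          rw [← ofReal_sub, Complex.norm_real, Real.norm_eq_abs]
          rwa [sub_sub_sub_cancel_left, abs_sub_comm])
      have h2 := hqK h
      have h3 := hf.transBound h
      calc _ ≤ _ := h1
        _ ≤ 8 * C ^ 2 * s₀ * (K * h ^ 2) + 8 * C ^ 2 * s₀ * (1 * h ^ 2) := by gcongr
        _ = 8 * C ^ 2 * s₀ * (K + 1) * h ^ 2 := by ring
        _ ≤ 1 / A * h ^ 2 := by gcongr
    · have := hb0 f hf s hs
      have h2 : energy (fun θ => ((s - N θ (bd f θ) : ℝ) : ℂ))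
          = energy (fun θ => (s - N θ (bd f θ))) := by
        simp only [energy, Complex.norm_real]
      rw [h2, le_div_iff₀ hA]
      linarith
  have hTs : ∀ f, SmallDisk e f → ∀ s : ℝ, |s| < δ → SmallDisk e (T s f) := by
    intro f hf s hs
    have hb := hbH f hf s hs
    obtain ⟨h1, -, h3⟩ := hL1 _ _ hb
    refine ⟨h1, ?_, ?_⟩
    · have := h3.transBound
      rwa [mul_one_div_cancel hA.ne'] at this
    · have h4 := hL2 _ _ _ _ hb h0b
      simp only [hL0, sub_zero] at h4
      exact h4.trans (hb0 f hf s hs)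
  have hTc : ∀ f g, SmallDisk e f → SmallDisk e g → ∀ s s' : ℝ, |s| < δ → |s'| < δ →
      energy (fun θ => bd (T s f) θ - bd (T s' g) θ)
        ≤ 4 * Real.pi * A * (s - s') ^ 2 + 1 / 2 * energy (fun θ => bd f θ - bd g θ) := by
    intro f g hf hg s s' hs hs'
    have h1 := hL2 _ _ _ _ (hbH f hf s hs) (hbH g hg s' hs')
    have h2 := hNen f g hf hg s s'
    have h3 := energy_nonneg fun θ => bd f θ - bd g θ
    calc _ ≤ _ := h1
      _ ≤ A * (4 * Real.pi * (s - s') ^ 2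
          + 16 * C ^ 2 * s₀ * energy (fun θ => bd f θ - bd g θ)) := by gcongr
      _ = 4 * Real.pi * A * (s - s') ^ 2
          + 2 * (8 * C ^ 2 * s₀ * A) * energy (fun θ => bd f θ - bd g θ) := by ring
      _ ≤ 4 * Real.pi * A * (s - s') ^ 2
          + 2 * (1 / 4) * energy (fun θ => bd f θ - bd g θ) := by gcongr
      _ = _ := by ring
  have hit : ∀ s : ℝ, |s| < δ → ∀ n, ∀ f, SmallDisk e f → SmallDisk e ((T s)^[n] f) := by
    intro s hs n
    induction n with
    | zero => exact fun f hf => hf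
    | succ n ih => exact fun f hf => ih _ (hTs f hf s hs)
  have hitc : ∀ s : ℝ, |s| < δ → ∀ n, ∀ f g, SmallDisk e f → SmallDisk e g →
      energy (fun θ => bd ((T s)^[n] f) θ - bd ((T s)^[n] g) θ)
        ≤ (1 / 2) ^ n * energy (fun θ => bd f θ - bd g θ) := by
    intro s hs n f g hf hg
    induction n with
    | zero => simp
    | succ n ih =>
      rw [Function.iterate_succ_apply', Function.iterate_succ_apply']
      have := hTc _ _ (hit s hs n f hf) (hit s hs n g hg) s s hs hs
      rw [sub_self] at this
      rw [pow_succ]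
      linarith
  have hcauchy : ∀ ε, 0 < ε → ∃ n₀, ∀ s : ℝ, |s| < δ → ∀ n ≥ n₀, ∀ m, ∀ z ∈ closedBall (0 : ℂ) 1,
      ‖(T s)^[n + m] 0 z - (T s)^[n] 0 z‖ ≤ ε := by
    intro ε hε
    obtain ⟨η, hη, h⟩ := SmallDisk.exists_close (e := e) hε
    obtain ⟨n₀, hn₀⟩ := exists_pow_lt_of_lt_one hη (show (1 / 2 : ℝ) < 1 by norm_num)
    refine ⟨n₀, fun s hs n hn m z hz => h _ _ (hit s hs _ _ hzero) (hit s hs _ _ hzero) ?_ z hz⟩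
    rw [Function.iterate_add_apply]
    have h1 := hitc s hs n _ _ (hit s hs m _ hzero) hzero
    have h0 : bd 0 = fun _ => 0 := rfl
    simp only [h0, sub_zero] at h1
    refine h1.trans ?_
    have h2 := (hit s hs m _ hzero).energy_le.trans he1
    have h3 := energy_nonneg (bd ((T s)^[m] 0))
    calc (1 / 2) ^ n * energy (bd ((T s)^[m] 0)) ≤ (1 / 2) ^ n₀ * 1 := by
          gcongr ?_ * ?_
          exact pow_le_pow_of_le_one (by norm_num) (by norm_num) hn
      _ ≤ η := by linarith
  have hlim : ∀ s : ℝ, |s| < δ → ∀ z ∈ closedBall (0 : ℂ) 1, ∃ w,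
      Tendsto (fun n => (T s)^[n] 0 z) atTop (𝓝 w) := by
    intro s hs z hz
    refine cauchySeq_tendsto_of_complete (Metric.cauchySeq_iff'.2 fun ε hε => ?_)
    obtain ⟨n₀, hn₀⟩ := hcauchy (ε / 2) (half_pos hε)
    refine ⟨n₀, fun n hn => ?_⟩
    obtain ⟨m, rfl⟩ := Nat.exists_eq_add_of_le hn
    rw [dist_eq_norm]
    exact (hn₀ s hs n₀ le_rfl m z hz).trans_lt (half_lt_self hε)
  choose! w hw using hlim
  have hunif : ∀ s : ℝ, |s| < δ →
      TendstoUniformlyOn (fun n => (T s)^[n] 0) (w s) atTop (closedBall 0 1) := by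
    intro s hs
    rw [Metric.tendstoUniformlyOn_iff]
    intro ε hε
    obtain ⟨n₀, hn₀⟩ := hcauchy (ε / 2) (half_pos hε)
    filter_upwards [eventually_ge_atTop n₀] with n hn z hz
    rw [dist_eq_norm]
    refine lt_of_le_of_lt ?_ (half_lt_self hε)
    have h1 := ((hw s hs z hz).comp (tendsto_add_atTop_nat n)).sub_const ((T s)^[n] 0 z)
    refine le_of_tendsto h1.norm (Eventually.of_forall fun m => ?_)
    have := hn₀ s hs n hn m z hz
    rwa [add_comm] at this
  have hwb : ∀ s : ℝ, |s| < δ → ∀ θ, Tendsto (fun n => bd ((T s)^[n] 0) θ) atTop (𝓝 (bd (w s) θ)) :=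
    fun s hs θ => hw s hs _ (circleMap_mem_closedBall_one θ)
  have hbdd : ∀ s : ℝ, |s| < δ → ∀ n θ, ‖bd ((T s)^[n] 0) θ‖ ≤ 1 := fun s hs n θ =>
    (hsup1 _ (hit s hs n _ hzero) θ).trans hsq1
  have hws : ∀ s : ℝ, |s| < δ → SmallDisk e (w s) := by
    intro s hs
    have hcs : ∀ n, Continuous (bd ((T s)^[n] 0)) := fun n =>
      (hit s hs n _ hzero).holDisk.continuous_bd
    refine ⟨⟨?_, ?_⟩, fun h => ?_, ?_⟩
    · exact (hunif s hs).continuousOn (Frequently.of_forall fun n => (hit s hs n _ hzero).holDisk.1)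
    · exact ((hunif s hs).mono ball_subset_closedBall).tendstoLocallyUniformlyOn.differentiableOn
        (Eventually.of_forall fun n => (hit s hs n _ hzero).holDisk.2) isOpen_ball
    · refine energy_le_of_tendsto (l := atTop)
        (v := fun n θ => bd ((T s)^[n] 0) (θ + h) - bd ((T s)^[n] 0) θ) (M := 2)
        (Eventually.of_forall fun n => by have := hcs n; fun_prop)
        (Eventually.of_forall fun n θ => ?_)
        (fun θ => (hwb s hs _).sub (hwb s hs _))
        (Eventually.of_forall fun n => (hit s hs n _ hzero).transBound h)
      refine (norm_sub_le _ _).trans ?_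
      have := hbdd s hs n (θ + h)
      have := hbdd s hs n θ
      linarith
    · exact energy_le_of_tendsto (l := atTop) (v := fun n => bd ((T s)^[n] 0)) (M := 1)
        (Eventually.of_forall hcs) (Eventually.of_forall (hbdd s hs)) (hwb s hs)
        (Eventually.of_forall fun n => (hit s hs n _ hzero).energy_le)
  have hen : ∀ s s' : ℝ, |s| < δ → |s'| < δ →
      energy (fun θ => bd (w s) θ - bd (w s') θ) ≤ 8 * Real.pi * A * (s - s') ^ 2 := by
    intro s s' hs hs'
    have hcs : ∀ s : ℝ, |s| < δ → ∀ n, Continuous (bd ((T s)^[n] 0)) := fun s hs n =>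
      (hit s hs n _ hzero).holDisk.continuous_bd
    refine energy_le_of_tendsto (l := atTop)
      (v := fun n θ => bd ((T s)^[n] 0) θ - bd ((T s')^[n] 0) θ) (M := 2)
      (Eventually.of_forall fun n => (hcs s hs n).sub (hcs s' hs' n))
      (Eventually.of_forall fun n θ => ?_)
      (fun θ => (hwb s hs _).sub (hwb s' hs' _)) (Eventually.of_forall fun n => ?_)
    · refine (norm_sub_le _ _).trans ?_
      have := hbdd s hs n θ
      have := hbdd s' hs' n θ
      linarith
    · have hpi := Real.pi_pos
      have hpos : 0 ≤ Real.pi * A * (s - s') ^ 2 := by positivity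
      induction n with
      | zero => simp [energy]; linarith
      | succ n ih =>
        rw [Function.iterate_succ_apply', Function.iterate_succ_apply']
        have := hTc _ _ (hit s hs n _ hzero) (hit s' hs' n _ hzero) s s' hs hs'
        linarith
  refine ⟨δ, hδ, w, fun s hs => ⟨(hws s hs).holDisk, (hws s hs).transBound,
    fun θ => (hsup1 _ (hws s hs) θ).trans hsq1, fun θ => ?_⟩, ?_, fun z hz => ?_⟩
  · have h1 : Tendsto (fun n => (Complex.exp (Λ θ) * bd ((T s)^[n + 1] 0) θ).re) atTop
        (𝓝 (Complex.exp (Λ θ) * bd (w s) θ).re) :=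
      (Complex.continuous_re.tendsto _).comp
        (((hwb s hs θ).comp (tendsto_add_atTop_nat 1)).const_mul _)
    have h2 : Tendsto (fun n => s - N θ (bd ((T s)^[n] 0) θ)) atTop (𝓝 (s - N θ (bd (w s) θ))) := by
      have : Continuous fun z => s - N θ z :=
        continuous_const.sub (hNc.comp (continuous_const.prodMk continuous_id))
      exact (this.tendsto _).comp (hwb s hs θ)
    refine tendsto_nhds_unique h1 (h2.congr fun n => ?_)
    rw [Function.iterate_succ_apply']
    exact ((hL1 _ _ (hbH _ (hit s hs n _ hzero) s hs)).2.1 θ).symm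
  · rintro ⟨z, s⟩ ⟨hz, hs⟩
    have hs1 : |s| < δ := abs_lt.2 hs
    rw [Metric.continuousWithinAt_iff]
    intro ε hε
    obtain ⟨η, hη, h⟩ := SmallDisk.exists_close (e := e) (show 0 < ε / 3 by positivity)
    obtain ⟨d₁, hd₁, h1⟩ := Metric.continuousWithinAt_iff.1 ((hws s hs1).holDisk.1 z hz) (ε / 3)
      (by positivity)
    have hpi := Real.pi_pos
    refine ⟨min d₁ √(η / (8 * Real.pi * A)), by positivity, ?_⟩
    rintro ⟨z', s'⟩ ⟨hz', hs'⟩ hd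
    have hs1' : |s'| < δ := abs_lt.2 hs'
    rw [Prod.dist_eq, max_lt_iff] at hd
    have h2 := h1 hz' (hd.1.trans_le (min_le_left _ _))
    have h3 : energy (fun θ => bd (w s') θ - bd (w s) θ) ≤ η := by
      refine (hen s' s hs1' hs1).trans ?_
      have h4 : |s' - s| < √(η / (8 * Real.pi * A)) := by
        have := hd.2.trans_le (min_le_right _ _)
        rwa [Real.dist_eq] at this
      have h5 : (s' - s) ^ 2 ≤ η / (8 * Real.pi * A) := by
        rw [← sq_abs, ← Real.sq_sqrt (show 0 ≤ η / (8 * Real.pi * A) by positivity)]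
        gcongr
      calc _ ≤ 8 * Real.pi * A * (η / (8 * Real.pi * A)) := by gcongr
        _ = η := by field_simp
    have h4 := h _ _ (hws s' hs1') (hws s hs1) h3 z' hz'
    rw [← dist_eq_norm] at h4
    have := dist_triangle (w s' z') (w s z') (w s z)
    linarith
  · have h0δ : |(0 : ℝ)| < δ := by simpa using hδ
    have h0 : bd 0 = fun _ => 0 := rfl
    have hn : ∀ n, energy (bd ((T 0)^[n] 0)) ≤ 0 := fun n => by
      induction n with
      | zero => simp [h0, energy]
      | succ n ih =>
        rw [Function.iterate_succ_apply']
        have h1 := hTc _ _ (hit 0 h0δ n _ hzero) hzero 0 0 h0δ h0δ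
        have h2 : T 0 0 = L fun _ => 0 := by simp [hT, h0, hN0]
        simp only [h2, hL0, h0, sub_zero] at h1
        simp only [ne_eq, OfNat.ofNat_ne_zero, not_false_eq_true, zero_pow, mul_zero, zero_add] at h1
        linarith
    have hw0 : energy (bd (w 0)) ≤ 0 :=
      energy_le_of_tendsto (l := atTop) (v := fun n => bd ((T 0)^[n] 0)) (M := 1)
        (Eventually.of_forall fun n => (hit 0 h0δ n _ hzero).holDisk.continuous_bd)
        (Eventually.of_forall (hbdd 0 h0δ)) (hwb 0 h0δ) (Eventually.of_forall hn)
    refine norm_le_zero_iff.1 (le_of_forall_pos_le_add fun ε hε => ?_)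
    obtain ⟨η, hη, h⟩ := SmallDisk.exists_close (e := e) hε
    have := h _ _ (hws 0 h0δ) hzero (by simp only [h0, sub_zero]; linarith) z hz
    simpa using this

end SmallSolutions

section DifferenceQuotients

open MeasureTheory Filter Topology

/-- On the convex set `Ω`, the function `f` is differentiable with derivative `f'`, which is
bounded by `C` and `C`-Lipschitz. -/
structure LipschitzDerivOn {V : Type*} [NormedAddCommGroup V] [NormedSpace ℝ V] (f : V → ℝ)
    (f' : V → V →L[ℝ] ℝ) (Ω : Set V) (C : ℝ) : Prop where
  convex : Convex ℝ Ω
  nonneg : 0 ≤ C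
  hasFDerivAt : ∀ p ∈ Ω, HasFDerivAt f (f' p) p
  bound : ∀ p ∈ Ω, ‖f' p‖ ≤ C
  lipschitz : ∀ p ∈ Ω, ∀ p' ∈ Ω, ‖f' p' - f' p‖ ≤ C * ‖p' - p‖

/-- The first order Taylor remainder is Lipschitz with small constant on small vectors. -/
theorem LipschitzDerivOn.remainder_sub_le {V : Type*} [NormedAddCommGroup V] [NormedSpace ℝ V]
    {f : V → ℝ} {f' : V → V →L[ℝ] ℝ} {Ω : Set V} {C : ℝ} (hf : LipschitzDerivOn f f' Ω C)
    {p v p' v' : V} (hp : p ∈ Ω) (hpv : p + v ∈ Ω) (hp' : p' ∈ Ω) (hpv' : p' + v' ∈ Ω) :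
    |(f (p' + v') - f p' - f' p' v') - (f (p + v) - f p - f' p v)|
      ≤ 3 * C * (‖v‖ + ‖v'‖) * (‖p' - p‖ + ‖v' - v‖) := by
  have hC := hf.nonneg
  set a := p' - p with ha
  set b := v' - v with hb
  have hP : ∀ s ∈ Icc (0 : ℝ) 1, p + s • a ∈ Ω := fun s hs =>
    hf.convex.add_smul_sub_mem hp hp' hs
  have hPV : ∀ s ∈ Icc (0 : ℝ) 1, (p + v) + s • (a + b) ∈ Ω := fun s hs => by
    have := hf.convex.add_smul_sub_mem hpv hpv' hs
    rwa [show p' + v' - (p + v) = a + b by rw [ha, hb]; abel] at this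
  have hlin : ∀ (x c : V) (s : ℝ), HasDerivAt (fun s : ℝ => x + s • c) c s := fun x c s => by
    have := ((hasDerivAt_id s).smul_const c).const_add x
    simpa using this
  have hb1 : ‖b‖ ≤ ‖v‖ + ‖v'‖ := by
    rw [hb, add_comm]
    exact norm_sub_le _ _
  have key := norm_image_sub_le_of_norm_deriv_le_segment_01'
    (f := fun s : ℝ => f ((p + v) + s • (a + b)) - f (p + s • a) - s * f' p b)
    (f' := fun s : ℝ => f' ((p + v) + s • (a + b)) (a + b) - f' (p + s • a) a - f' p b)
    (C := C * (‖v‖ + ‖v'‖) * (2 * ‖a‖ + ‖b‖)) (fun s hs => by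
      have h1 := (hf.hasFDerivAt _ (hPV s hs)).comp_hasDerivAt s (hlin (p + v) (a + b) s)
      have h2 := (hf.hasFDerivAt _ (hP s hs)).comp_hasDerivAt s (hlin p a s)
      have h3 := (hasDerivAt_id s).mul_const (f' p b)
      rw [one_mul] at h3
      exact ((h1.sub h2).sub h3).hasDerivWithinAt) (fun s hs => by
      have hs' : s ∈ Icc (0 : ℝ) 1 := ⟨hs.1, hs.2.le⟩
      have e : f' ((p + v) + s • (a + b)) (a + b) - f' (p + s • a) a - f' p b
          = (f' ((p + v) + s • (a + b)) - f' (p + s • a)) a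
            + (f' ((p + v) + s • (a + b)) - f' p) b := by
        simp only [map_add, sub_apply]
        ring
      have hvs : ‖v + s • b‖ ≤ ‖v‖ + ‖v'‖ := by
        have : v + s • b = (1 - s) • v + s • v' := by
          rw [hb, smul_sub, sub_smul, one_smul]
          abel
        rw [this]
        refine (norm_add_le _ _).trans ?_
        rw [norm_smul, norm_smul, Real.norm_eq_abs, Real.norm_eq_abs, abs_of_nonneg hs.1,
          abs_of_nonneg (by linarith [hs.2] : 0 ≤ 1 - s)]
        have := norm_nonneg v
        have := norm_nonneg v'
        have h1 := hs.1
        have h2 := hs.2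
        nlinarith
      have h1 : ‖f' ((p + v) + s • (a + b)) - f' (p + s • a)‖ ≤ C * (‖v‖ + ‖v'‖) := by
        refine (hf.lipschitz _ (hP s hs') _ (hPV s hs')).trans ?_
        rw [show (p + v) + s • (a + b) - (p + s • a) = v + s • b by rw [smul_add]; abel]
        gcongr
      have h2 : ‖f' ((p + v) + s • (a + b)) - f' p‖ ≤ C * ((‖v‖ + ‖v'‖) + ‖a‖) := by
        refine (hf.lipschitz _ hp _ (hPV s hs')).trans ?_
        rw [show (p + v) + s • (a + b) - p = (v + s • b) + s • a by rw [smul_add]; abel]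
        gcongr
        refine (norm_add_le _ _).trans (add_le_add hvs ?_)
        rw [norm_smul, Real.norm_eq_abs, abs_of_nonneg hs.1]
        exact mul_le_of_le_one_left (norm_nonneg a) hs.2.le
      rw [e]
      refine (norm_add_le _ _).trans ?_
      have h3 := ContinuousLinearMap.le_of_opNorm_le _ h1 a
      have h4 := ContinuousLinearMap.le_of_opNorm_le _ h2 b
      have h5 : C * ‖a‖ * ‖b‖ ≤ C * ‖a‖ * (‖v‖ + ‖v'‖) := by gcongr
      linarith)
  have hlast : |(f' p' - f' p) v'| ≤ C * ‖a‖ * (‖v‖ + ‖v'‖) := by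
    have h1 := ContinuousLinearMap.le_of_opNorm_le _ (hf.lipschitz p hp p' hp') v'
    rw [← Real.norm_eq_abs]
    refine h1.trans ?_
    gcongr
    exact le_add_of_nonneg_left (norm_nonneg v)
  have e : (f (p' + v') - f p' - f' p' v') - (f (p + v) - f p - f' p v)
      = ((f ((p + v) + (1 : ℝ) • (a + b)) - f (p + (1 : ℝ) • a) - 1 * f' p b)
        - (f ((p + v) + (0 : ℝ) • (a + b)) - f (p + (0 : ℝ) • a) - 0 * f' p b))
        - (f' p' - f' p) v' := by
    have e1 : (p + v) + (1 : ℝ) • (a + b) = p' + v' := by rw [one_smul, ha, hb]; abel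
    have e2 : p + (1 : ℝ) • a = p' := by rw [one_smul, ha]; abel
    rw [e1, e2]
    simp only [zero_smul, add_zero, hb, map_sub, sub_apply]
    ring
  rw [e]
  refine (abs_sub _ _).trans ?_
  rw [Real.norm_eq_abs] at key
  have : 0 ≤ C * (‖v‖ + ‖v'‖) * ‖b‖ := by positivity
  linarith

/-- A translation bound which improves itself by a factor is universal. -/
theorem TransBound.of_halving {E : Type*} [NormedAddCommGroup E] {u : ℝ → E} {X₀ b : ℝ}
    (h0 : TransBound u X₀) (h : ∀ X, TransBound u X → TransBound u (X / 2 + b)) :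
    TransBound u (2 * b) := by
  have h1 : ∀ n : ℕ, TransBound u (2 * b + (X₀ - 2 * b) * (1 / 2) ^ n) := fun n => by
    induction n with
    | zero => simpa using h0
    | succ n ih =>
      refine (h _ ih).mono (le_of_eq ?_)
      rw [pow_succ]
      ring
  intro t
  have h2 : Tendsto (fun n : ℕ => (2 * b + (X₀ - 2 * b) * (1 / 2) ^ n) * t ^ 2) atTop
      (𝓝 ((2 * b + (X₀ - 2 * b) * 0) * t ^ 2)) :=
    (((tendsto_pow_atTop_nhds_zero_of_lt_one (by norm_num) (by norm_num)).const_mul _).const_add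
      _).mul_const _
  rw [mul_zero, add_zero] at h2
  exact ge_of_tendsto' h2 fun n => h1 n t

theorem HolDisk.exists_uniform_shift {x : ℂ → ℂ} (hx : HolDisk x) {μ : ℝ} (hμ : 0 < μ) :
    ∃ d, 0 < d ∧ ∀ h : ℝ, |h| ≤ d → ∀ θ, ‖bd x (θ + h) - bd x θ‖ ≤ μ := by
  have h1 := (isCompact_closedBall (0 : ℂ) 1).uniformContinuousOn_of_continuous hx.1
  obtain ⟨d, hd, h2⟩ := Metric.uniformContinuousOn_iff_le.1 h1 μ hμ
  refine ⟨d, hd, fun h hh θ => ?_⟩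
  rw [← dist_eq_norm]
  refine h2 _ (circleMap_mem_closedBall_one _) _ (circleMap_mem_closedBall_one _) ?_
  have := (lipschitzWith_circleMap 0 1).dist_le_mul (θ + h) θ
  refine this.trans ?_
  simpa [Real.dist_eq] using hh

/-- The difference quotient of a holomorphic disk, along the boundary circle. -/
def diffQuot (x : ℂ → ℂ) (h : ℝ) : ℂ → ℂ := fun z => (h⁻¹ : ℝ) * (x (Complex.exp (h * I) * z) - x z)

theorem HolDisk.diffQuot {x : ℂ → ℂ} (hx : HolDisk x) (h : ℝ) : HolDisk (diffQuot x h) :=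
  ((hx.rotate h).sub hx).const_mul _

theorem bd_diffQuot (x : ℂ → ℂ) (h : ℝ) :
    bd (diffQuot x h) = fun θ => h⁻¹ • (bd x (θ + h) - bd x θ) := by
  funext θ
  rw [← congrFun (bd_rotate x h) θ, Complex.real_smul]
  rfl

theorem TransBound.energy_diffQuot_le {E : Type*} [NormedAddCommGroup E] [NormedSpace ℝ E]
    {u : ℝ → E} {K : ℝ} (hu : TransBound u K) (h : ℝ) :
    energy (fun θ => h⁻¹ • (u (θ + h) - u θ)) ≤ K := by
  rw [energy_const_smul]
  have hK := hu.nonneg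
  rcases eq_or_ne h 0 with rfl | hh
  · simpa using hK
  · calc h⁻¹ ^ 2 * energy (fun θ => u (θ + h) - u θ) ≤ h⁻¹ ^ 2 * (K * h ^ 2) := by
          gcongr
          exact hu h
      _ = K := by field_simp

theorem TransBound.prodMk {E G : Type*} [NormedAddCommGroup E] [NormedAddCommGroup G]
    {u : ℝ → E} {v : ℝ → G} {K K' : ℝ} (hu : Continuous u) (hv : Continuous v)
    (hK : TransBound u K) (hK' : TransBound v K') :
    TransBound (fun θ => (u θ, v θ)) (K + K') := fun h => by
  have := energy_le_of_sq_le_two (u := fun θ => (u (θ + h), v (θ + h)) - (u θ, v θ))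
    (v₁ := fun θ => u (θ + h) - u θ) (v₂ := fun θ => v (θ + h) - v θ) (c₁ := 1) (c₂ := 1)
    (by fun_prop) (by fun_prop) (by fun_prop) (fun θ => by
      rw [Prod.mk_sub_mk, Prod.norm_mk, one_mul, one_mul]
      rcases max_choice ‖u (θ + h) - u θ‖ ‖v (θ + h) - v θ‖ with hm | hm <;> rw [hm] <;>
        nlinarith [sq_nonneg ‖u (θ + h) - u θ‖, sq_nonneg ‖v (θ + h) - v θ‖])
  have h1 := hK h
  have h2 := hK' h
  linarith

theorem halving_arith {A C Kp M S Y Kx Kw Xe μ ν s : ℝ} (hA : 0 ≤ A)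
    (hKp : 0 ≤ Kp) (hY : 0 ≤ Y) (hs2 : s ^ 2 = S * (ν * Y + 2 * ν⁻¹ ^ 3 * Kx))
    (hμ : 108 * A * C ^ 2 * μ ^ 2 ≤ 1 / 4) (hν : 294 * A * C ^ 2 * Kp * S * ν ≤ 1 / 4) :
    A * (147 * C ^ 2 * (M + s) ^ 2 * Kp + 147 * C ^ 2 * Kw + 108 * C ^ 2 * μ ^ 2 * Y
        + 3 * S * Xe * Kx + Kx)
      ≤ Y / 2 + A * (147 * C ^ 2 * Kp * (2 * M ^ 2 + 2 * (S * (2 * ν⁻¹ ^ 3 * Kx)))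
        + 147 * C ^ 2 * Kw + 3 * S * Xe * Kx + Kx) := by
  have i1 : (M + s) ^ 2 ≤ 2 * M ^ 2 + 2 * s ^ 2 := by nlinarith [sq_nonneg (M - s)]
  have i2 : A * (147 * C ^ 2 * (M + s) ^ 2 * Kp)
      ≤ A * (147 * C ^ 2 * (2 * M ^ 2 + 2 * s ^ 2) * Kp) := by gcongr
  rw [hs2] at i2
  have i3 := mul_le_mul_of_nonneg_right hν hY
  have i4 := mul_le_mul_of_nonneg_right hμ hY
  linarith

set_option maxHeartbeats 1000000 in
/-- Boundary regularity: if the curve `(y, x)` lies in a level set of `f`, where `x` is the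
boundary value of a holomorphic disk and `∂f/∂x ≠ 0` is `H¹` along the curve, then the
difference quotients of `x` are as regular as those of `y`. -/
theorem exists_diffQuot_bound {U : Type*} [NormedAddCommGroup U] [NormedSpace ℝ U]
    {f : U × ℂ → ℝ} {f' : U × ℂ → U × ℂ →L[ℝ] ℝ} {Ω : Set (U × ℂ)} {C c : ℝ}
    (hf : LipschitzDerivOn f f' Ω C) {x : ℂ → ℂ} {Kx : ℝ} (hx : HolDisk x)
    (hxK : TransBound (bd x) Kx) {y : ℝ → U} {Ky : ℝ} (hy : Continuous y) (hyK : TransBound y Ky)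
    (hp : ∀ θ, (y θ, bd x θ) ∈ Ω) (hlev : ∀ θ, f (y θ, bd x θ) = c) {Λ : ℝ → ℂ} {X : ℝ}
    (hΛ : H1Bound Λ X)
    (hΛf : ∀ θ v, f' (y θ, bd x θ) (0, v) = (Complex.exp (Λ θ) * v).re) {M Kw : ℝ}
    (hM : ∀ h θ, ‖y (θ + h) - y θ‖ ≤ M * |h|)
    (hw : ∀ᶠ h in 𝓝[≠] (0 : ℝ), TransBound (fun θ => h⁻¹ • (y (θ + h) - y θ)) Kw) :
    ∃ Y, ∀ᶠ h in 𝓝[≠] (0 : ℝ), TransBound (bd (diffQuot x h)) Y := by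
  obtain ⟨A, hA, hap⟩ := exists_apriori_bound hΛ
  obtain ⟨Xe, hXe⟩ := hΛ.cexp
  have hXe0 := hXe.nonneg
  have hS := sobolevConst_nonneg
  have hC := hf.nonneg
  have hM0 : 0 ≤ M := by simpa using (norm_nonneg _).trans (hM 1 0)
  have hKx := hxK.nonneg
  have hKy := hyK.nonneg
  have hxc := hx.continuous_bd
  set S := sobolevConst with hSdef
  have hpc : Continuous fun θ => (y θ, bd x θ) := by fun_prop
  have hpK := hyK.prodMk hy hxc hxK
  set Kp := Ky + Kx
  have hKp : 0 ≤ Kp := hpK.nonneg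
  obtain ⟨μ, hμ, hμ1, hμ2⟩ : ∃ μ, 0 < μ ∧ μ ≤ 1 ∧ 108 * A * C ^ 2 * μ ^ 2 ≤ 1 / 4 := by
    refine ⟨min 1 (1 / (432 * A * C ^ 2 + 1)), by positivity, min_le_left _ _, ?_⟩
    set m := min 1 (1 / (432 * A * C ^ 2 + 1)) with hm
    have h1 : m ≤ 1 := min_le_left _ _
    have h2 : m * (432 * A * C ^ 2 + 1) ≤ 1 := by
      rw [← le_div_iff₀ (by positivity)]
      exact min_le_right _ _
    have h0 : 0 < m := by positivity
    have h3 : 0 ≤ A * C ^ 2 * m := by positivity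
    nlinarith
  obtain ⟨ν, hν, hν1, hν2⟩ : ∃ ν, 0 < ν ∧ ν ≤ 1 ∧ 294 * A * C ^ 2 * Kp * S * ν ≤ 1 / 4 := by
    refine ⟨min 1 (1 / (4 * (294 * A * C ^ 2 * Kp * S) + 1)), by positivity, min_le_left _ _, ?_⟩
    set m := min 1 (1 / (4 * (294 * A * C ^ 2 * Kp * S) + 1)) with hm
    have h2 : m * (4 * (294 * A * C ^ 2 * Kp * S) + 1) ≤ 1 := by
      rw [← le_div_iff₀ (by positivity)]
      exact min_le_right _ _
    have h0 : 0 < m := by positivity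
    nlinarith
  obtain ⟨d, hd, hdx⟩ := hx.exists_uniform_shift hμ
  set b : ℝ := A * (147 * C ^ 2 * Kp * (2 * M ^ 2 + 2 * (S * (2 * ν⁻¹ ^ 3 * Kx)))
    + 147 * C ^ 2 * Kw + 3 * S * Xe * Kx + Kx) with hb
  have hball : ∀ᶠ h in 𝓝[≠] (0 : ℝ), |h| ≤ d ∧ M * |h| ≤ μ := by
    refine eventually_nhdsWithin_of_eventually_nhds ?_
    refine ((continuous_abs.tendsto (0 : ℝ)).eventually_le_const (by simpa using hd)).and ?_
    refine ((continuous_abs.const_mul M).tendsto (0 : ℝ)).eventually_le_const (by simpa using hμ)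
  refine ⟨2 * b, ?_⟩
  filter_upwards [hw, hball, self_mem_nhdsWithin] with h hwh hhd hh0
  have hh : h ≠ 0 := hh0
  have hKw := hwh.nonneg
  have hDx := bd_diffQuot x h
  set D := diffQuot x h with hD
  have hDh : HolDisk D := hx.diffQuot h
  have hDc := hDh.continuous_bd
  have hDe : energy (bd D) ≤ Kx := by
    rw [hDx]
    exact hxK.energy_diffQuot_le h
  set w : ℝ → U := fun θ => h⁻¹ • (y (θ + h) - y θ) with hwdef
  have hwc : Continuous w := by fun_prop
  have hwM : ∀ θ, ‖w θ‖ ≤ M := fun θ => by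
    rw [hwdef, norm_smul, norm_inv, Real.norm_eq_abs, inv_mul_le_iff₀ (abs_pos.2 hh), mul_comm]
    exact hM h θ
  set p : ℝ → U × ℂ := fun θ => (y θ, bd x θ) with hpdef
  set ω : ℝ → U × ℂ := fun θ => (w θ, bd D θ) with hω
  have hpω : ∀ θ, p θ + h • ω θ = p (θ + h) := fun θ => by
    rw [hpdef, hω, hwdef, hDx]
    simp only [Prod.smul_mk, smul_smul, mul_inv_cancel₀ hh, one_smul, Prod.mk_add_mk,
      add_sub_cancel]
  have hωμ : ∀ θ, |h| * ‖ω θ‖ ≤ μ := fun θ => by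
    rw [← Real.norm_eq_abs, ← norm_smul, eq_sub_of_add_eq' (hpω θ), hpdef, Prod.mk_sub_mk,
      Prod.norm_mk]
    exact max_le ((hM h θ).trans hhd.2) (hdx h hhd.1 θ)
  set B : ℝ → ℝ := fun θ => (Complex.exp (Λ θ) * bd D θ).re with hB
  have hBeq : ∀ θ, B θ = -(h⁻¹ * (f (p θ + h • ω θ) - f (p θ) - f' (p θ) (h • ω θ)))
      - f' (p θ) (w θ, 0) := fun θ => by
    rw [hpω, show f (p (θ + h)) = c from hlev _, show f (p θ) = c from hlev θ, sub_self, zero_sub,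
      map_smul, smul_eq_mul, mul_neg, neg_neg, inv_mul_cancel_left₀ hh, ← map_sub]
    change (Complex.exp (Λ θ) * bd D θ).re = _
    rw [← hΛf]
    simp [hω, hpdef]
  have hBc : Continuous B := by
    have := hXe.continuous
    fun_prop
  have hBe : energy B ≤ 3 * S * Xe * Kx := by
    have := energy_le_of_sq_le_one (u := B) (v₁ := bd D) (c₁ := 3 * S * Xe) hBc hDc (fun θ => by
      have h1 := hXe.norm_sq_le θ
      have h2 := Complex.abs_re_le_norm (Complex.exp (Λ θ) * bd D θ)
      rw [norm_mul] at h2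
      calc ‖B θ‖ ^ 2 ≤ (‖Complex.exp (Λ θ)‖ * ‖bd D θ‖) ^ 2 := by
            gcongr
            exact h2
        _ ≤ _ := by
            rw [mul_pow]
            gcongr)
    refine this.trans ?_
    gcongr
  have hBp : Function.Periodic B (2 * Real.pi) := fun θ => by
    simp only [hB, hΛ.periodic θ, bd_periodic D θ]
  have hX0 : TransBound (bd D) (h⁻¹ ^ 2 * (4 * Kx)) := by
    rw [hDx]
    exact hxK.diff_quotient hxc (bd_periodic x) h
  refine hX0.of_halving fun Y hY => ?_
  have hY0 := hY.nonneg
  set s : ℝ := √(S * (ν * Y + 2 * ν⁻¹ ^ 3 * Kx)) with hs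
  have hs2 : s ^ 2 = S * (ν * Y + 2 * ν⁻¹ ^ 3 * Kx) := Real.sq_sqrt (by positivity)
  have hs0 : 0 ≤ s := Real.sqrt_nonneg _
  have hDs : ∀ θ, ‖bd D θ‖ ≤ s := fun θ => by
    refine Real.le_sqrt_of_sq_le ((hY.norm_sq_le hDc (bd_periodic D) hν hν1 θ).trans ?_)
    gcongr
  have hωs : ∀ θ, ‖ω θ‖ ≤ M + s := fun θ => by
    rw [hω, Prod.norm_mk]
    exact max_le (by linarith [hwM θ]) (by linarith [hDs θ])
  have hδB : ∀ θ θ', |B θ' - B θ| ≤ 7 * C * (M + s) * ‖p θ' - p θ‖ + 7 * C * ‖w θ' - w θ‖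
      + 6 * C * μ * ‖bd D θ' - bd D θ‖ := by
    intro θ θ'
    have hr := hf.remainder_sub_le (hp θ) (v := h • ω θ) (by rw [hpω]; exact hp _) (hp θ')
      (v' := h • ω θ') (by rw [hpω]; exact hp _)
    have h1 : ‖f' (p θ') (w θ', 0) - f' (p θ) (w θ, 0)‖ ≤ C * M * ‖p θ' - p θ‖ + C * ‖w θ' - w θ‖ := by
      have e : f' (p θ') (w θ', 0) - f' (p θ) (w θ, 0)
          = (f' (p θ') - f' (p θ)) (w θ', 0) + f' (p θ) (w θ' - w θ, 0) := by
        rw [sub_apply, show ((w θ' - w θ, 0) : U × ℂ) = (w θ', 0) - (w θ, 0) by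
          simp, map_sub]
        ring
      rw [e]
      refine (norm_add_le _ _).trans (add_le_add ?_ ?_)
      · refine (ContinuousLinearMap.le_of_opNorm_le _ (hf.lipschitz _ (hp θ) _ (hp θ')) _).trans ?_
        have : ‖((w θ', 0) : U × ℂ)‖ ≤ M := by simpa [Prod.norm_mk] using hwM θ'
        calc C * ‖p θ' - p θ‖ * ‖((w θ', 0) : U × ℂ)‖ ≤ C * ‖p θ' - p θ‖ * M := by gcongr
          _ = _ := by ring
      · refine (ContinuousLinearMap.le_of_opNorm_le _ (hf.bound _ (hp θ)) _).trans ?_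
        simp [Prod.norm_mk]
    have hωd : ‖ω θ' - ω θ‖ ≤ ‖w θ' - w θ‖ + ‖bd D θ' - bd D θ‖ := by
      rw [hω, Prod.mk_sub_mk, Prod.norm_mk]
      exact max_le (le_add_of_nonneg_right (norm_nonneg _)) (le_add_of_nonneg_left (norm_nonneg _))
    have h2 : |h⁻¹ * (f (p θ' + h • ω θ') - f (p θ') - f' (p θ') (h • ω θ'))
        - h⁻¹ * (f (p θ + h • ω θ) - f (p θ) - f' (p θ) (h • ω θ))|
        ≤ 6 * C * (M + s) * ‖p θ' - p θ‖ + 6 * C * μ * (‖w θ' - w θ‖ + ‖bd D θ' - bd D θ‖) := by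
      rw [← mul_sub, abs_mul, abs_inv, inv_mul_le_iff₀ (abs_pos.2 hh)]
      refine hr.trans ?_
      rw [← smul_sub, norm_smul, norm_smul, norm_smul, Real.norm_eq_abs]
      have i1 : 3 * C * (|h| * ‖ω θ‖ + |h| * ‖ω θ'‖) * ‖p θ' - p θ‖
          ≤ 3 * C * (|h| * (M + s) + |h| * (M + s)) * ‖p θ' - p θ‖ := by
        gcongr
        · exact hωs θ
        · exact hωs θ'
      have i2 : 3 * C * (|h| * ‖ω θ‖ + |h| * ‖ω θ'‖) * (|h| * ‖ω θ' - ω θ‖)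
          ≤ 3 * C * (μ + μ) * (|h| * (‖w θ' - w θ‖ + ‖bd D θ' - bd D θ‖)) := by
        gcongr
        · exact hωμ θ
        · exact hωμ θ'
      linarith
    have e : B θ' - B θ = -(h⁻¹ * (f (p θ' + h • ω θ') - f (p θ') - f' (p θ') (h • ω θ'))
        - h⁻¹ * (f (p θ + h • ω θ) - f (p θ) - f' (p θ) (h • ω θ)))
        - (f' (p θ') (w θ', 0) - f' (p θ) (w θ, 0)) := by
      rw [hBeq, hBeq]
      ring
    rw [e]
    refine (abs_sub _ _).trans ?_
    rw [abs_neg]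
    rw [Real.norm_eq_abs] at h1
    have i3 : 6 * C * μ * ‖w θ' - w θ‖ ≤ 6 * C * 1 * ‖w θ' - w θ‖ := by gcongr
    have i4 : 0 ≤ C * s * ‖p θ' - p θ‖ := by positivity
    linarith
  have hBt : TransBound (fun θ => (B θ : ℂ)) (147 * C ^ 2 * (M + s) ^ 2 * Kp + 147 * C ^ 2 * Kw
      + 108 * C ^ 2 * μ ^ 2 * Y) := fun t => by
    have := energy_le_of_sq_le (u := fun θ => (B (θ + t) : ℂ) - (B θ : ℂ))
      (v₁ := fun θ => p (θ + t) - p θ) (v₂ := fun θ => w (θ + t) - w θ)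
      (v₃ := fun θ => bd D (θ + t) - bd D θ) (c₁ := 147 * C ^ 2 * (M + s) ^ 2)
      (c₂ := 147 * C ^ 2) (c₃ := 108 * C ^ 2 * μ ^ 2) (by fun_prop) (by fun_prop) (by fun_prop)
      (by fun_prop) (fun θ => by
        rw [← ofReal_sub, Complex.norm_real, Real.norm_eq_abs]
        set a₁ := 7 * C * (M + s) * ‖p (θ + t) - p θ‖
        set a₂ := 7 * C * ‖w (θ + t) - w θ‖
        set a₃ := 6 * C * μ * ‖bd D (θ + t) - bd D θ‖
        calc |B (θ + t) - B θ| ^ 2 ≤ (a₁ + a₂ + a₃) ^ 2 := by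
              gcongr
              exact hδB θ (θ + t)
          _ ≤ 3 * a₁ ^ 2 + 3 * a₂ ^ 2 + 3 * a₃ ^ 2 := by
              nlinarith [sq_nonneg (a₁ - a₂), sq_nonneg (a₁ - a₃), sq_nonneg (a₂ - a₃)]
          _ = _ := by
              simp only [a₁, a₂, a₃]
              ring)
    have h1 := hpK t
    have h2 := hwh t
    have h3 := hY t
    calc _ ≤ _ := this
      _ ≤ 147 * C ^ 2 * (M + s) ^ 2 * (Kp * t ^ 2) + 147 * C ^ 2 * (Kw * t ^ 2)
          + 108 * C ^ 2 * μ ^ 2 * (Y * t ^ 2) := by gcongr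
      _ = _ := by ring
  set KB := 147 * C ^ 2 * (M + s) ^ 2 * Kp + 147 * C ^ 2 * Kw + 108 * C ^ 2 * μ ^ 2 * Y with hKB
  have hKB0 : 0 ≤ KB := by positivity
  have hBH : H1Bound (fun θ => (B θ : ℂ)) (KB + 3 * S * Xe * Kx) := by
    refine ⟨by fun_prop, fun θ => by simp only [hBp θ], hBt.mono ?_, ?_⟩
    · have : 0 ≤ 3 * S * Xe * Kx := by positivity
      linarith
    · have : energy (fun θ => (B θ : ℂ)) = energy B := by simp only [energy, Complex.norm_real]
      linarith
  refine (hap D B Kx _ hDh (fun θ => rfl) hBH hDe).transBound.mono ?_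
  rw [hKB, hb]
  exact halving_arith hA.le hKp hY0 hs2 hμ2 hν2

end DifferenceQuotients

section SmoothData

open MeasureTheory Filter Topology

theorem exists_continuous_log {A : Type*} [TopologicalSpace A] [SimplyConnectedSpace A]
    [LocallyPathConnectedSpace A] {a : A → ℂ} (ha : Continuous a) (ha0 : ∀ p, a p ≠ 0) :
    ∃ l : A → ℂ, Continuous l ∧ ∀ p, Complex.exp (l p) = a p := by
  have p₀ : A := Classical.arbitrary A
  obtain ⟨l, ⟨-, hl⟩, -⟩ := isCoveringMapOn_exp.existsUnique_continuousMap_lifts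
    ⟨a, ha⟩ (a₀ := p₀) (Complex.exp_log (ha0 p₀)) ha0
  exact ⟨l, l.continuous, fun p => congrFun hl p⟩

/-- A continuous logarithm is as smooth as its exponential. -/
theorem eventuallyEq_log {A : Type*} [TopologicalSpace A] {l : A → ℂ} {p : A}
    (hl : ContinuousAt l p) :
    l =ᶠ[𝓝 p] fun q => Complex.log (Complex.exp (l q) / Complex.exp (l p)) + l p := by
  have h1 : ContinuousAt (fun q => (l q - l p).im) p := by fun_prop
  have h2 : ∀ᶠ q in 𝓝 p, (l q - l p).im ∈ Ioo (-Real.pi) Real.pi :=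
    h1.eventually (Ioo_mem_nhds (by simpa using Real.pi_pos) (by simpa using Real.pi_pos))
  filter_upwards [h2] with q hq
  rw [← Complex.exp_sub, Complex.log_exp hq.1 hq.2.le, sub_add_cancel]

theorem contDiff_of_exp {V : Type*} [NormedAddCommGroup V] [NormedSpace ℝ V] {n : WithTop ℕ∞}
    {l : V → ℂ} (hl : Continuous l) (he : ContDiff ℝ n fun p => Complex.exp (l p)) :
    ContDiff ℝ n l := by
  rw [contDiff_iff_contDiffAt]
  intro p
  refine ContDiffAt.congr_of_eventuallyEq ?_ (eventuallyEq_log hl.continuousAt)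
  refine ContDiffAt.add ?_ contDiffAt_const
  have h1 : ContDiffAt ℝ n (fun q => Complex.exp (l q) / Complex.exp (l p)) p := by
    simp only [div_eq_mul_inv]
    exact he.contDiffAt.mul contDiffAt_const
  refine ContDiffAt.comp p (g := Complex.log) ?_ h1
  refine (Complex.contDiffAt_log ?_).restrict_scalars ℝ
  rw [div_self (Complex.exp_ne_zero _)]
  exact Complex.one_mem_slitPlane

theorem differentiableAt_of_exp {l : ℂ → ℂ} {z : ℂ} (hl : ContinuousAt l z)
    (he : DifferentiableAt ℂ (fun z => Complex.exp (l z)) z) : DifferentiableAt ℂ l z := by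
  refine DifferentiableAt.congr_of_eventuallyEq ?_ (eventuallyEq_log hl)
  refine DifferentiableAt.add_const _ (DifferentiableAt.clog (he.div_const _) ?_)
  rw [div_self (Complex.exp_ne_zero _)]
  exact Complex.one_mem_slitPlane

theorem Function.Periodic.exists_bound {V E : Type*} [NormedAddCommGroup V] [NormedAddCommGroup E]
    {g : V → E} {T : V} (hg : Continuous g) (hp : Function.Periodic g T) {Ω K : Set V}
    (hK : IsCompact K) (hΩ : ∀ p ∈ Ω, ∃ n : ℤ, p + n • T ∈ K) :
    ∃ C, 0 ≤ C ∧ ∀ p ∈ Ω, ‖g p‖ ≤ C := by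
  obtain ⟨C, hC⟩ := hK.exists_bound_of_continuousOn hg.continuousOn
  refine ⟨max C 0, le_max_right _ _, fun p hpΩ => ?_⟩
  obtain ⟨n, hn⟩ := hΩ p hpΩ
  rw [← hp.zsmul n p]
  exact (hC _ hn).trans (le_max_left _ _)

theorem Function.Periodic.fderiv {V E : Type*} [NormedAddCommGroup V] [NormedSpace ℝ V]
    [NormedAddCommGroup E] [NormedSpace ℝ E] {g : V → E} {T : V} (hp : Function.Periodic g T) :
    Function.Periodic (fderiv ℝ g) T := fun p => by
  rw [← fderiv_comp_add_right]
  congr 1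
  exact funext hp

theorem Function.Periodic.exists_lipschitz {V E : Type*} [NormedAddCommGroup V] [NormedSpace ℝ V]
    [NormedAddCommGroup E] [NormedSpace ℝ E] {g : V → E} {T : V} (hg : ContDiff ℝ 1 g)
    (hp : Function.Periodic g T) {Ω K : Set V} (hK : IsCompact K)
    (hΩ : ∀ p ∈ Ω, ∃ n : ℤ, p + n • T ∈ K) (hc : Convex ℝ Ω) :
    ∃ C, 0 ≤ C ∧ ∀ p ∈ Ω, ∀ p' ∈ Ω, ‖g p' - g p‖ ≤ C * ‖p' - p‖ := by
  obtain ⟨C, hC0, hC⟩ := hp.fderiv.exists_bound (hg.continuous_fderiv one_ne_zero) hK hΩ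
  exact ⟨C, hC0, fun p h p' h' => hc.norm_image_sub_le_of_norm_fderiv_le
    (fun q _ => (hg.differentiable one_ne_zero) q) hC h h'⟩

theorem LipschitzDerivOn.of_periodic {V : Type*} [NormedAddCommGroup V] [NormedSpace ℝ V]
    {f : V → ℝ} {T : V} (hf : ContDiff ℝ 2 f) (hp : Function.Periodic f T) {Ω K : Set V}
    (hK : IsCompact K) (hΩ : ∀ p ∈ Ω, ∃ n : ℤ, p + n • T ∈ K) (hc : Convex ℝ Ω) :
    ∃ C, LipschitzDerivOn f (_root_.fderiv ℝ f) Ω C := by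
  have h1 : ContDiff ℝ 1 (_root_.fderiv ℝ f) := hf.fderiv_right (by norm_num [one_add_one_eq_two])
  obtain ⟨C₁, h10, hC₁⟩ := hp.fderiv.exists_bound h1.continuous hK hΩ
  obtain ⟨C₂, h20, hC₂⟩ := hp.fderiv.exists_lipschitz h1 hK hΩ hc
  refine ⟨max C₁ C₂, hc, h10.trans (le_max_left _ _), fun p _ =>
    ((hf.differentiable two_ne_zero) p).hasFDerivAt, fun p hpΩ => (hC₁ p hpΩ).trans (le_max_left _ _),
    fun p hpΩ p' hp' => (hC₂ p hpΩ p' hp').trans ?_⟩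
  gcongr
  exact le_max_right _ _

/-- The bounded strip `|ζ| < R` in `ℝ × ℂ`. -/
def strip (R : ℝ) : Set (ℝ × ℂ) := univ ×ˢ ball 0 R

theorem exists_zsmul_mem_Icc (θ : ℝ) : ∃ n : ℤ, θ + n • (2 * Real.pi) ∈ Icc 0 (2 * Real.pi) := by
  obtain ⟨n, hn, -⟩ := existsUnique_add_zsmul_mem_Ico Real.two_pi_pos θ 0
  exact ⟨n, by rw [zero_add] at hn; exact Ico_subset_Icc_self hn⟩

theorem convex_strip (R : ℝ) : Convex ℝ (strip R) := convex_univ.prod (convex_ball _ _)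

theorem strip_reduction (R : ℝ) : ∀ p ∈ strip R, ∃ n : ℤ,
    p + n • ((2 * Real.pi, 0) : ℝ × ℂ) ∈ Icc 0 (2 * Real.pi) ×ˢ closedBall (0 : ℂ) R := by
  rintro ⟨θ, ζ⟩ ⟨-, h⟩
  obtain ⟨n, hn⟩ := exists_zsmul_mem_Icc θ
  exact ⟨n, hn, by simpa using ball_subset_closedBall h⟩

theorem isCompact_strip (R : ℝ) : IsCompact (Icc 0 (2 * Real.pi) ×ˢ closedBall (0 : ℂ) R) :=
  isCompact_Icc.prod (isCompact_closedBall _ _)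

theorem strip_prod_reduction (R R' : ℝ) : ∀ p ∈ strip R ×ˢ ball (0 : ℂ) R', ∃ n : ℤ,
    p + n • (((2 * Real.pi, 0), 0) : (ℝ × ℂ) × ℂ)
      ∈ (Icc 0 (2 * Real.pi) ×ˢ closedBall (0 : ℂ) R) ×ˢ closedBall (0 : ℂ) R' := by
  rintro ⟨p, ζ⟩ ⟨hp, h⟩
  obtain ⟨n, hn⟩ := strip_reduction R p hp
  exact ⟨n, hn, by simpa using ball_subset_closedBall h⟩

/-- The family in the coordinates `(θ, ζ) ↦ (e^{iθ}, e^ζ)`. -/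
def logFamily (F : ℂ → ℂ → ℝ) : ℝ × ℂ → ℝ := fun p => F (circleMap 0 1 p.1) (Complex.exp p.2)

theorem logFamily_periodic (F : ℂ → ℂ → ℝ) : Function.Periodic (logFamily F) (2 * Real.pi, 0) :=
  fun p => by simp [logFamily, periodic_circleMap 0 1 p.1]

theorem circleMap_mem_unitSphere (θ : ℝ) : circleMap 0 1 θ ∈ sphere (0 : ℂ) 1 :=
  circleMap_mem_sphere 0 zero_le_one θ

theorem IsSmoothTorusFamily.contDiff_logFamily {F : ℂ → ℂ → ℝ} (hF : IsSmoothTorusFamily F) :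
    ContDiff ℝ (⊤ : ℕ∞) (logFamily F) := by
  have h1 : ContDiff ℝ (⊤ : ℕ∞) (fun p : ℝ × ℂ => (circleMap 0 1 p.1, Complex.exp p.2)) :=
    ((contDiff_circleMap 0 1).comp contDiff_fst).prodMk (Complex.contDiff_exp.comp contDiff_snd)
  exact hF.1.comp_contDiff h1 fun p => ⟨circleMap_mem_unitSphere _, mem_univ _⟩

/-- Twice the Wirtinger derivative of the family in the second logarithmic coordinate. -/
def logWirt (F : ℂ → ℂ → ℝ) : ℝ × ℂ → ℂ := fun p =>
  (fderiv ℝ (logFamily F) p (0, 1) : ℝ) - (fderiv ℝ (logFamily F) p (0, I) : ℝ) * I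

theorem fderiv_logFamily_snd (F : ℂ → ℂ → ℝ) (p : ℝ × ℂ) (v : ℂ) :
    fderiv ℝ (logFamily F) p (0, v) = (logWirt F p * v).re := by
  have h : ((0, v) : ℝ × ℂ) = v.re • ((0, 1) : ℝ × ℂ) + v.im • ((0, I) : ℝ × ℂ) := by
    ext <;> simp
  rw [h, map_add, map_smul, map_smul, logWirt]
  simp only [mul_re, mul_im, sub_re, sub_im, ofReal_re, ofReal_im, I_re, I_im, smul_eq_mul]
  ring

theorem IsSmoothTorusFamily.logWirt_ne_zero {F : ℂ → ℂ → ℝ} (hF : IsSmoothTorusFamily F)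
    (p : ℝ × ℂ) : logWirt F p ≠ 0 := by
  obtain ⟨θ, ζ⟩ := p
  intro h0
  have hl := circleMap_mem_unitSphere θ
  refine hF.2.2.2.2.1 _ hl _ (Complex.exp_ne_zero ζ) ?_
  have hFd : HasFDerivAt (F (circleMap 0 1 θ)) (fderiv ℝ (F (circleMap 0 1 θ)) (Complex.exp ζ))
      (Complex.exp ζ) := ((hF.2.1 _ hl).differentiable (by simp) _).hasFDerivAt
  have hE : ∀ v, fderiv ℝ (F (circleMap 0 1 θ)) (Complex.exp ζ) v = 0 := fun v => by
    have hc1 : HasDerivAt (fun s : ℝ => Complex.exp (ζ + s * (v / Complex.exp ζ))) v 0 := by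
      have h1 : HasDerivAt (fun s : ℂ => Complex.exp (ζ + s * (v / Complex.exp ζ))) v
          ((0 : ℝ) : ℂ) := by
        have := (((hasDerivAt_id ((0 : ℝ) : ℂ)).mul_const (v / Complex.exp ζ)).const_add ζ).cexp
        simpa [mul_div_cancel₀, Complex.exp_ne_zero] using this
      exact h1.comp_ofReal
    have h2 : HasDerivAt (fun s : ℝ => F (circleMap 0 1 θ)
        (Complex.exp (ζ + s * (v / Complex.exp ζ))))
        (fderiv ℝ (F (circleMap 0 1 θ)) (Complex.exp ζ) v) 0 := by
      have := HasFDerivAt.comp_hasDerivAt (x := (0 : ℝ))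
        (f := fun s : ℝ => Complex.exp (ζ + s * (v / Complex.exp ζ)))
        (l := F (circleMap 0 1 θ)) (l' := fderiv ℝ (F (circleMap 0 1 θ)) (Complex.exp ζ))
        (by simpa using hFd) hc1
      exact this
    have h3 : HasDerivAt (fun s : ℝ => logFamily F (θ, ζ + s * (v / Complex.exp ζ)))
        (fderiv ℝ (logFamily F) (θ, ζ) (0, v / Complex.exp ζ)) 0 := by
      have hd : HasFDerivAt (logFamily F) (fderiv ℝ (logFamily F) (θ, ζ)) (θ, ζ) :=
        (hF.contDiff_logFamily.differentiable (by simp) _).hasFDerivAt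
      have hc : HasDerivAt (fun s : ℝ => ((θ, ζ + s * (v / Complex.exp ζ)) : ℝ × ℂ))
          (0, v / Complex.exp ζ) 0 := by
        refine (hasDerivAt_const _ _).prodMk ?_
        have := (((hasDerivAt_id ((0 : ℝ) : ℂ)).mul_const (v / Complex.exp ζ)).const_add ζ)
        simpa using this.comp_ofReal
      exact HasFDerivAt.comp_hasDerivAt (x := (0 : ℝ)) (by simpa using hd) hc
    rw [fderiv_logFamily_snd, h0, zero_mul, zero_re] at h3
    exact h2.unique h3
  simp [wirt, hE]

theorem IsSmoothTorusFamily.contDiff_logWirt {F : ℂ → ℂ → ℝ} (hF : IsSmoothTorusFamily F) :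
    ContDiff ℝ (⊤ : ℕ∞) (logWirt F) := by
  have h1 : ContDiff ℝ (⊤ : ℕ∞) (fderiv ℝ (logFamily F)) :=
    hF.contDiff_logFamily.fderiv_right (by simp)
  have h2 : ∀ v, ContDiff ℝ (⊤ : ℕ∞) fun p => ((fderiv ℝ (logFamily F) p v : ℝ) : ℂ) := fun v =>
    Complex.ofRealCLM.contDiff.comp (h1.clm_apply contDiff_const)
  exact (h2 _).sub ((h2 _).mul contDiff_const)

theorem IsSmoothTorusFamily.exists_logWirt_eq {F : ℂ → ℂ → ℝ} (hF : IsSmoothTorusFamily F) :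
    ∃ ζ : ℂ, ∀ θ θ' : ℝ, logWirt F (θ, ζ) = logWirt F (θ', ζ) := by
  obtain ⟨ε, hε, h⟩ := hF.2.2.1
  have hev : ∀ᶠ ζ in comap Complex.re atBot, Complex.normSq (Complex.exp ζ) < ε := by
    have h1 := (Complex.continuous_normSq.tendsto 0).comp Complex.tendsto_exp_comap_re_atBot
    rw [map_zero] at h1
    exact h1.eventually (gt_mem_nhds hε)
  have : (comap Complex.re atBot).NeBot := atBot_neBot.comap_of_surj Complex.re_surjective
  obtain ⟨ζ, hζ⟩ := hev.exists
  refine ⟨ζ, fun θ θ' => ?_⟩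
  have key : ∀ θ : ℝ, fderiv ℝ (logFamily F) (θ, ζ)
      = fderiv ℝ (fun p : ℝ × ℂ => Complex.normSq (Complex.exp p.2)) (θ, ζ) := fun θ => by
    refine Filter.EventuallyEq.fderiv_eq ?_
    have hc : Continuous fun p : ℝ × ℂ => Complex.normSq (Complex.exp p.2) :=
      Complex.continuous_normSq.comp (by fun_prop)
    filter_upwards [hc.continuousAt.eventually (gt_mem_nhds hζ)] with p hp
    exact h _ (circleMap_mem_unitSphere _) _ hp
  have hp : Function.Periodic (fun p : ℝ × ℂ => Complex.normSq (Complex.exp p.2)) (θ' - θ, 0) :=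
    fun p => by simp
  have := hp.fderiv (θ, ζ)
  rw [Prod.mk_add_mk, add_sub_cancel, add_zero] at this
  simp only [logWirt, key, this]

/-- The phase of the family: a smooth periodic logarithm of `logWirt F`. -/
theorem IsSmoothTorusFamily.exists_phase {F : ℂ → ℂ → ℝ} (hF : IsSmoothTorusFamily F) :
    ∃ Λ : ℝ × ℂ → ℂ, ContDiff ℝ (⊤ : ℕ∞) Λ ∧ Function.Periodic Λ (2 * Real.pi, 0) ∧
      ∀ p v, fderiv ℝ (logFamily F) p (0, v) = (Complex.exp (Λ p) * v).re := by
  have hs := hF.contDiff_logWirt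
  obtain ⟨Λ, hΛ, hexp⟩ := exists_continuous_log hs.continuous hF.logWirt_ne_zero
  refine ⟨Λ, contDiff_of_exp hΛ (by simpa only [hexp] using hs), ?_, fun p v => by
    rw [hexp, fderiv_logFamily_snd]⟩
  have hloc : ∀ {A : Type} [TopologicalSpace A] [PreconnectedSpace A] {l : A → ℂ},
      Continuous l → (∀ q q', Complex.exp (l q) = Complex.exp (l q')) → ∀ q q', l q = l q' := by
    intro A _ _ l hl he
    refine (IsLocallyConstant.iff_eventually_eq l).2 (fun q => ?_) |>.apply_eq_of_preconnectedSpace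
    filter_upwards [eventuallyEq_log hl.continuousAt] with q' hq'
    rw [hq', he q' q, div_self (Complex.exp_ne_zero _), Complex.log_one, zero_add]
  have hper : ∀ p : ℝ × ℂ, Complex.exp (Λ (p + (2 * Real.pi, 0))) = Complex.exp (Λ p) := fun p => by
    simp only [hexp, logWirt, (logFamily_periodic F).fderiv p]
  obtain ⟨ζ, hζ⟩ := hF.exists_logWirt_eq
  intro p
  have h1 := hloc (l := fun p => Λ (p + (2 * Real.pi, 0)) - Λ p) (by fun_prop)
    (fun q q' => by simp only [Complex.exp_sub, hper, div_self (Complex.exp_ne_zero _)]) p (0, ζ)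
  have h2 := hloc (l := fun θ : ℝ => Λ (θ, ζ)) (by fun_prop)
    (fun q q' => by rw [hexp, hexp, hζ]) (2 * Real.pi) 0
  have h3 : Λ ((0, ζ) + (2 * Real.pi, 0)) = Λ (0, ζ) := by
    rw [Prod.mk_add_mk, zero_add, add_zero]
    exact h2
  simp only [h3, sub_self] at h1
  exact sub_eq_zero.1 h1

end SmoothData

section Regularity

open MeasureTheory Filter Topology

theorem summable_nat_mul_cf {u : ℝ → ℂ} {K : ℝ} (hu : Continuous u)
    (hp : Function.Periodic u (2 * Real.pi))
    (hK : ∀ᶠ h : ℝ in 𝓝[≠] 0, TransBound (fun θ => h⁻¹ • (u (θ + h) - u θ)) K) :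
    Summable fun n : ℕ => (n : ℝ) * ‖cf u n‖ := by
  have h1 : Summable fun n : ℤ => (n : ℝ) ^ 4 * ‖cf u n‖ ^ 2 :=
    summable_of_sum_le (fun n => by positivity) (sum_cf_le_of_diff_quotient hu hp hK)
  have h2 : Summable fun n : ℕ => ((n : ℤ) : ℝ) ^ 4 * ‖cf u n‖ ^ 2 :=
    h1.comp_injective Nat.cast_injective
  have h3 : Summable fun n : ℕ => 1 / (n : ℝ) ^ 2 := Real.summable_one_div_nat_pow.2 one_lt_two
  refine Summable.of_nonneg_of_le (fun n => by positivity) (fun n => ?_) (h2.add h3)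
  rcases Nat.eq_zero_or_pos n with rfl | hn
  · simp
  · have hn' : (0 : ℝ) < n := by exact_mod_cast hn
    have e : (n : ℝ) * ‖cf u n‖ = ((n : ℝ) ^ 2 * ‖cf u n‖) * (1 / n) := by field_simp
    have e2 : (((n : ℤ) : ℝ)) ^ 4 * ‖cf u n‖ ^ 2 + 1 / (n : ℝ) ^ 2
        = ((n : ℝ) ^ 2 * ‖cf u n‖) ^ 2 + (1 / (n : ℝ)) ^ 2 := by
      push_cast
      ring
    rw [e, e2]
    nlinarith [sq_nonneg ((n : ℝ) ^ 2 * ‖cf u n‖ - 1 / n),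
      sq_nonneg ((n : ℝ) ^ 2 * ‖cf u n‖ + 1 / n)]

theorem hasDerivAt_bd_powSum {a : ℕ → ℂ} (ha : Summable fun n : ℕ => (n : ℝ) * ‖a n‖)
    (ha0 : Summable fun n => ‖a n‖) (θ : ℝ) :
    HasDerivAt (bd (powSum a)) (I * circleMap 0 1 θ *
      powSum (fun n : ℕ => ((n : ℂ) + 1) * a (n + 1)) (circleMap 0 1 θ)) θ := by
  have hn : ∀ θ : ℝ, ‖circleMap 0 1 θ‖ = 1 := fun θ => by simp
  have hb : ∀ (n : ℕ) (θ : ℝ), ‖(n : ℂ) * a n * circleMap 0 1 θ ^ n * I‖ ≤ (n : ℝ) * ‖a n‖ :=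
    fun n θ => by simp
  have key := hasDerivAt_tsum (g := fun (n : ℕ) (θ : ℝ) => a n * circleMap 0 1 θ ^ n)
    (g' := fun (n : ℕ) (θ : ℝ) => (n : ℂ) * a n * circleMap 0 1 θ ^ n * I) ha
    (fun n θ => by
      have h1 := ((hasDerivAt_circleMap 0 1 θ).pow n).const_mul (a n)
      refine h1.congr_deriv ?_
      rcases n with _ | n
      · simp
      · rw [pow_succ (circleMap 0 1 θ) n, Nat.add_sub_cancel]
        ring) hb (y₀ := θ) (hasSum_powSum ha0 (circleMap_mem_closedBall_one θ)).summable θ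
  refine key.congr_deriv ?_
  have hs : Summable fun n : ℕ => (n : ℂ) * a n * circleMap 0 1 θ ^ n * I :=
    Summable.of_norm_bounded ha fun n => hb n θ
  rw [hs.tsum_eq_zero_add, powSum, ← tsum_mul_left]
  simp only [Nat.cast_zero, zero_mul, zero_add]
  refine tsum_congr fun n => ?_
  push_cast
  ring

theorem norm_sub_le_of_hasDerivAt {u u' : ℝ → ℂ} {M : ℝ} (hu : ∀ θ, HasDerivAt u (u' θ) θ)
    (hM : ∀ θ, ‖u' θ‖ ≤ M) (x y : ℝ) : ‖u y - u x‖ ≤ M * |y - x| :=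
  convex_univ.norm_image_sub_le_of_norm_hasDerivWithin_le
    (fun θ _ => (hu θ).hasDerivWithinAt) (fun θ _ => hM θ) (mem_univ x) (mem_univ y)

theorem TransBound.of_diff_quotient {u u' : ℝ → ℂ} {M Y : ℝ}
    (hu : ∀ θ, HasDerivAt u (u' θ) θ) (hM : ∀ θ, ‖u' θ‖ ≤ M)
    (hY : ∀ᶠ h : ℝ in 𝓝[≠] 0, TransBound (fun θ => h⁻¹ • (u (θ + h) - u θ)) Y) :
    TransBound u' Y := by
  have hc : Continuous u := continuous_iff_continuousAt.2 fun θ => (hu θ).continuousAt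
  have hlim : ∀ θ, Tendsto (fun h : ℝ => h⁻¹ • (u (θ + h) - u θ)) (𝓝[≠] 0) (𝓝 (u' θ)) :=
    fun θ => (hu θ).tendsto_slope_zero
  have hb : ∀ h θ, ‖h⁻¹ • (u (θ + h) - u θ)‖ ≤ M := fun h θ => by
    rw [norm_smul, norm_inv, Real.norm_eq_abs]
    rcases eq_or_ne h 0 with rfl | hh
    · simpa using (norm_nonneg _).trans (hM 0)
    · rw [inv_mul_le_iff₀ (abs_pos.2 hh), mul_comm]
      simpa using norm_sub_le_of_hasDerivAt hu hM θ (θ + h)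
  intro t
  refine energy_le_of_tendsto (l := 𝓝[≠] (0 : ℝ)) (M := M + M)
    (v := fun h θ => h⁻¹ • (u (θ + t + h) - u (θ + t)) - h⁻¹ • (u (θ + h) - u θ))
    (Eventually.of_forall fun h => by fun_prop)
    (Eventually.of_forall fun h θ => (norm_sub_le _ _).trans (add_le_add (hb _ _) (hb _ _)))
    (fun θ => (hlim _).sub (hlim _)) ?_
  filter_upwards [hY] with h hh
  exact hh t

/-- The disk `z ↦ i z f(z)`; for `f = x'` its boundary values are the angular derivative
of `x`. -/
def angular (f : ℂ → ℂ) : ℂ → ℂ := fun z => I * z * f z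

theorem HolDisk.angular {f : ℂ → ℂ} (hf : HolDisk f) : HolDisk (angular f) :=
  HolDisk.mul ⟨by fun_prop, by fun_prop⟩ hf

theorem HolDisk.exists_bound {f : ℂ → ℂ} (hf : HolDisk f) :
    ∃ M, ∀ z ∈ closedBall (0 : ℂ) 1, ‖f z‖ ≤ M :=
  (isCompact_closedBall 0 1).exists_bound_of_continuousOn hf.1

theorem HolDisk.exists_deriv {x : ℂ → ℂ} {K Y : ℝ} (hx : HolDisk x) (hK : TransBound (bd x) K)
    (hY : ∀ᶠ h in 𝓝[≠] (0 : ℝ), TransBound (bd (_root_.diffQuot x h)) Y) :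
    ∃ x', HolDisk x' ∧ (∀ z ∈ ball (0 : ℂ) 1, HasDerivAt x (x' z) z) ∧
      ∀ θ, HasDerivAt (bd x) (bd (_root_.angular x') θ) θ := by
  simp only [bd_diffQuot] at hY
  have h1 := summable_nat_mul_cf hx.continuous_bd (bd_periodic x) hY
  have h2 := hK.summable_cf hx.continuous_bd (bd_periodic x)
  have h3 := hx.eqOn_powSum h2
  obtain ⟨h4, h5⟩ := hasDerivAt_powSum h1
  refine ⟨_, holDisk_powSum h4, fun z hz => (h5 z hz).congr_of_eventuallyEq ?_, fun θ => ?_⟩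
  · exact h3.eventuallyEq_of_mem (closedBall_mem_nhds_of_mem hz)
  · have h6 : bd x = bd (powSum fun n : ℕ => cf (bd x) n) :=
      funext fun θ => h3 (circleMap_mem_closedBall_one θ)
    have h7 := hasDerivAt_bd_powSum h1 (h2.comp_injective Nat.cast_injective) θ
    rw [← h6] at h7
    exact h7

theorem norm_sub_le_on_closedBall {f f' : ℂ → ℂ} {C : ℝ}
    (hf : ContinuousOn f (closedBall 0 1)) (hd : ∀ z ∈ ball (0 : ℂ) 1, HasDerivAt f (f' z) z)
    (hC : ∀ z ∈ ball (0 : ℂ) 1, ‖f' z‖ ≤ C) :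
    ∀ z ∈ closedBall (0 : ℂ) 1, ∀ w ∈ closedBall (0 : ℂ) 1, ‖f z - f w‖ ≤ C * ‖z - w‖ := by
  have hC0 : 0 ≤ C := (norm_nonneg _).trans (hC 0 (by simp))
  have h1 : LipschitzOnWith ⟨C, hC0⟩ f (ball 0 1) :=
    (convex_ball 0 1).lipschitzOnWith_of_nnnorm_hasDerivWithin_le
      (fun z hz => (hd z hz).hasDerivWithinAt) hC
  have h2 := LipschitzOnWith.closure (by rwa [closure_ball _ one_ne_zero]) h1
  rw [closure_ball _ one_ne_zero] at h2
  intro z hz w hw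
  have := h2.dist_le_mul z hz w hw
  rwa [dist_eq_norm, dist_eq_norm] at this

theorem HolDisk.lipschitz {f f' : ℂ → ℂ} (hf : HolDisk f) (hf' : HolDisk f')
    (hd : ∀ z ∈ ball (0 : ℂ) 1, HasDerivAt f (f' z) z) :
    ∃ C, 0 ≤ C ∧ ∀ z ∈ closedBall (0 : ℂ) 1, ∀ w ∈ closedBall (0 : ℂ) 1,
      ‖f z - f w‖ ≤ C * ‖z - w‖ := by
  obtain ⟨C, hC⟩ := hf'.exists_bound
  exact ⟨C, (norm_nonneg _).trans (hC 0 (by simp)),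
    norm_sub_le_on_closedBall hf.1 hd fun z hz => hC z (ball_subset_closedBall hz)⟩

/-- If `z f(z)` has bounded derivative on the disk then so does `f`. -/
theorem HolDisk.lipschitz_of_angular {f L' : ℂ → ℂ} (hf : HolDisk f) (hL' : HolDisk L')
    (hd : ∀ z ∈ ball (0 : ℂ) 1, HasDerivAt (_root_.angular f) (L' z) z) :
    ∃ C, 0 ≤ C ∧ ∀ z ∈ closedBall (0 : ℂ) 1, ∀ w ∈ closedBall (0 : ℂ) 1,
      ‖f z - f w‖ ≤ C * ‖z - w‖ := by
  obtain ⟨A, hA⟩ := hf.exists_bound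
  obtain ⟨B, hB⟩ := hL'.exists_bound
  obtain ⟨D, hD⟩ := (isCompact_closedBall (0 : ℂ) (1 / 2)).exists_bound_of_continuousOn
    ((hf.2.deriv isOpen_ball).continuousOn.mono (closedBall_subset_ball (by norm_num)))
  have hf' : ∀ z ∈ ball (0 : ℂ) 1, HasDerivAt f (deriv f z) z := fun z hz =>
    (hf.2.differentiableAt (isOpen_ball.mem_nhds hz)).hasDerivAt
  refine ⟨max D (2 * (A + B)), le_max_of_le_left ((norm_nonneg _).trans (hD 0 (by simp))),
    norm_sub_le_on_closedBall hf.1 hf' fun z hz => ?_⟩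
  by_cases h : ‖z‖ ≤ 1 / 2
  · exact (hD z (by simpa using h)).trans (le_max_left _ _)
  · refine le_trans ?_ (le_max_right _ _)
    have h1 := (hd z hz).unique ((((hasDerivAt_id z).const_mul I)).mul (hf' z hz))
    have h2 : I * z * deriv f z = L' z - I * f z := by
      rw [h1, id, mul_one]
      ring
    have h3 := congrArg norm h2
    rw [norm_mul, norm_mul, norm_I, one_mul] at h3
    have h4 := norm_sub_le (L' z) (I * f z)
    rw [norm_mul, norm_I, one_mul] at h4
    have h5 := hA z (ball_subset_closedBall hz)
    have h6 := hB z (ball_subset_closedBall hz)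
    have h7 := norm_nonneg (deriv f z)
    push Not at h
    nlinarith

theorem TransBound.comp_lipschitz {E G : Type*} [NormedAddCommGroup E] [NormedAddCommGroup G]
    {u : ℝ → E} {v : ℝ → G} {K C : ℝ} (hu : Continuous u) (hv : Continuous v)
    (hK : TransBound u K) (h : ∀ θ θ', ‖v θ' - v θ‖ ≤ C * ‖u θ' - u θ‖) :
    TransBound v (C ^ 2 * K) := fun t => by
  have := energy_le_of_sq_le_one (u := fun θ => v (θ + t) - v θ) (v₁ := fun θ => u (θ + t) - u θ)
    (c₁ := C ^ 2) (by fun_prop) (by fun_prop) (fun θ => by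
      rw [← mul_pow]
      exact pow_le_pow_left₀ (norm_nonneg _) (h _ _) 2)
  have h1 := mul_le_mul_of_nonneg_left (hK t) (sq_nonneg C)
  linarith

theorem transBound_id : TransBound (fun θ : ℝ => θ) (2 * Real.pi) := fun t => by
  simp [energy_const]

theorem HolDisk.transBound_prodMk {l : ℂ → ℂ} {K : ℝ} (hl : HolDisk l) (hK : TransBound (bd l) K) :
    TransBound (fun θ => (θ, bd l θ)) (2 * Real.pi + K) :=
  transBound_id.prodMk continuous_id hl.continuous_bd hK

theorem HolDisk.exists_mem_strip {l : ℂ → ℂ} (hl : HolDisk l) :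
    ∃ R, ∀ θ, ∀ v ∈ closedBall (0 : ℂ) 1, (θ, bd l θ + v) ∈ strip R := by
  obtain ⟨M, hM⟩ := hl.exists_bound
  refine ⟨M + 2, fun θ v hv => ⟨mem_univ _, ?_⟩⟩
  rw [mem_closedBall_zero_iff] at hv
  rw [mem_ball_zero_iff]
  have h1 := hM _ (circleMap_mem_closedBall_one θ)
  have h2 := norm_add_le (bd l θ) v
  have : ‖bd l θ‖ ≤ M := h1
  change ‖bd l θ + v‖ < M + 2
  linarith

theorem exists_H1Bound_phase {Λ : ℝ × ℂ → ℂ} (hΛ : ContDiff ℝ (⊤ : ℕ∞) Λ)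
    (hp : Function.Periodic Λ (2 * Real.pi, 0)) {l : ℂ → ℂ} {K : ℝ} (hl : HolDisk l)
    (hK : TransBound (bd l) K) : ∃ X, H1Bound (fun θ => Λ (θ, bd l θ)) X := by
  obtain ⟨R, hR⟩ := hl.exists_mem_strip
  have hR' : ∀ θ, (θ, bd l θ) ∈ strip R := fun θ => by simpa using hR θ 0 (by simp)
  obtain ⟨C, -, hC⟩ := hp.exists_lipschitz (hΛ.of_le (by simp)) (isCompact_strip R)
    (strip_reduction R) (convex_strip R)
  have hc := hl.continuous_bd
  have hc2 := hΛ.continuous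
  refine H1Bound.of_transBound (by fun_prop) (fun θ => ?_)
    ((hl.transBound_prodMk hK).comp_lipschitz (by fun_prop) (by fun_prop)
      fun θ θ' => hC _ (hR' θ) _ (hR' θ'))
  rw [← hp (θ, bd l θ), bd_periodic, Prod.mk_add_mk, add_zero]

end Regularity

section DiskRegularity

open MeasureTheory Filter Topology

/-- The derivative of the family along the vectors `(1, ζ')`. -/
def logFamilyAlong (F : ℂ → ℂ → ℝ) : (ℝ × ℂ) × ℂ → ℝ := fun q =>
  fderiv ℝ (logFamily F) q.1 (1, q.2)

theorem IsSmoothTorusFamily.contDiff_logFamilyAlong {F : ℂ → ℂ → ℝ} (hF : IsSmoothTorusFamily F) :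
    ContDiff ℝ (⊤ : ℕ∞) (logFamilyAlong F) := by
  have h1 : ContDiff ℝ (⊤ : ℕ∞) (fderiv ℝ (logFamily F)) :=
    hF.contDiff_logFamily.fderiv_right (by simp)
  exact (h1.comp contDiff_fst).clm_apply (contDiff_const.prodMk contDiff_snd)

theorem logFamilyAlong_periodic (F : ℂ → ℂ → ℝ) :
    Function.Periodic (logFamilyAlong F) ((2 * Real.pi, 0), 0) := fun q => by
  simp only [logFamilyAlong, Prod.fst_add, Prod.snd_add, add_zero, (logFamily_periodic F).fderiv q.1]

theorem IsSmoothTorusFamily.fderiv_logFamilyAlong_snd {F : ℂ → ℂ → ℝ}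
    (hF : IsSmoothTorusFamily F) (q : (ℝ × ℂ) × ℂ) (v : ℂ) :
    fderiv ℝ (logFamilyAlong F) q (0, v) = fderiv ℝ (logFamily F) q.1 (0, v) := by
  have h1 : HasFDerivAt (logFamilyAlong F) (fderiv ℝ (logFamilyAlong F) q) q :=
    (hF.contDiff_logFamilyAlong.differentiable (by simp) q).hasFDerivAt
  have hc : HasDerivAt (fun s : ℝ => q + s • ((0, v) : (ℝ × ℂ) × ℂ)) (0, v) 0 := by
    simpa using ((hasDerivAt_id (0 : ℝ)).smul_const ((0, v) : (ℝ × ℂ) × ℂ)).const_add q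
  have h2 : HasDerivAt (fun s : ℝ => logFamilyAlong F (q + s • ((0, v) : (ℝ × ℂ) × ℂ)))
      (fderiv ℝ (logFamilyAlong F) q (0, v)) 0 :=
    HasFDerivAt.comp_hasDerivAt (x := (0 : ℝ)) (l := logFamilyAlong F)
      (f := fun s : ℝ => q + s • ((0, v) : (ℝ × ℂ) × ℂ)) (l' := fderiv ℝ (logFamilyAlong F) q)
      (by simpa using h1) hc
  have h3 : (fun s : ℝ => logFamilyAlong F (q + s • ((0, v) : (ℝ × ℂ) × ℂ)))
      = fun s : ℝ => logFamilyAlong F q + s * fderiv ℝ (logFamily F) q.1 (0, v) := by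
    funext s
    have e : ((1, q.2 + s • v) : ℝ × ℂ) = (1, q.2) + s • (0, v) := by simp
    simp only [logFamilyAlong, Prod.smul_mk, smul_zero, Prod.fst_add, Prod.snd_add, add_zero]
    rw [e, map_add, map_smul, smul_eq_mul]
  rw [h3] at h2
  refine h2.unique ?_
  simpa using ((hasDerivAt_id (0 : ℝ)).mul_const
    (fderiv ℝ (logFamily F) q.1 (0, v))).const_add (logFamilyAlong F q)

/-- Holomorphic disks of class `H¹` attached to a level set of the family have Lipschitz
derivative. -/
theorem IsSmoothTorusFamily.exists_lipschitz_deriv {F : ℂ → ℂ → ℝ} (hF : IsSmoothTorusFamily F)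
    {l : ℂ → ℂ} {K c : ℝ} (hl : HolDisk l) (hK : TransBound (bd l) K)
    (hlev : ∀ θ, logFamily F (θ, bd l θ) = c) :
    ∃ l', HolDisk l' ∧ (∀ z ∈ ball (0 : ℂ) 1, HasDerivAt l (l' z) z) ∧
      ∃ C, 0 ≤ C ∧ ∀ z ∈ closedBall (0 : ℂ) 1, ∀ w ∈ closedBall (0 : ℂ) 1,
        ‖l' z - l' w‖ ≤ C * ‖z - w‖ := by
  obtain ⟨Λ, hΛ, hΛp, hΛf⟩ := hF.exists_phase
  obtain ⟨X, hX⟩ := exists_H1Bound_phase hΛ hΛp hl hK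
  obtain ⟨R, hR⟩ := hl.exists_mem_strip
  have hR' : ∀ θ, (θ, bd l θ) ∈ strip R := fun θ => by simpa using hR θ 0 (by simp)
  have hlc := hl.continuous_bd
  obtain ⟨C₁, hC₁⟩ := LipschitzDerivOn.of_periodic (contDiff_infty.1 hF.contDiff_logFamily 2)
    (logFamily_periodic F) (isCompact_strip R) (strip_reduction R) (convex_strip R)
  have hw1 : ∀ h : ℝ, TransBound (fun θ : ℝ => h⁻¹ • (θ + h - θ)) 0 := fun h t => by
    simp [energy_const]
  obtain ⟨Y₁, hY₁⟩ := exists_diffQuot_bound hC₁ hl hK continuous_id transBound_id hR' hlev hX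
    (fun θ v => hΛf _ v) (M := 1) (fun h θ => by simp) (Eventually.of_forall hw1)
  obtain ⟨l', hl', hd, hbd⟩ := hl.exists_deriv hK hY₁
  refine ⟨l', hl', hd, ?_⟩
  have hL := hl'.angular
  obtain ⟨M, hM⟩ := hL.exists_bound
  have hM' : ∀ θ, ‖bd (angular l') θ‖ ≤ M := fun θ => hM _ (circleMap_mem_closedBall_one θ)
  simp only [bd_diffQuot] at hY₁
  have hLK := TransBound.of_diff_quotient hbd hM' hY₁
  obtain ⟨C₂, hC₂⟩ := LipschitzDerivOn.of_periodic (contDiff_infty.1 hF.contDiff_logFamilyAlong 2)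
    (logFamilyAlong_periodic F) ((isCompact_strip R).prod (isCompact_closedBall 0 (M + 1)))
    (strip_prod_reduction R (M + 1)) ((convex_strip R).prod (convex_ball 0 (M + 1)))
  have hlev' : ∀ θ, logFamilyAlong F ((θ, bd l θ), bd (angular l') θ) = 0 := fun θ => by
    have h1 : HasFDerivAt (logFamily F) (fderiv ℝ (logFamily F) (θ, bd l θ)) (θ, bd l θ) :=
      (hF.contDiff_logFamily.differentiable (by simp) _).hasFDerivAt
    have h2 : HasDerivAt (fun θ => logFamily F (θ, bd l θ))
        (fderiv ℝ (logFamily F) (θ, bd l θ) (1, bd (angular l') θ)) θ :=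
      HasFDerivAt.comp_hasDerivAt (x := θ) (f := fun θ => (θ, bd l θ)) h1 ((hasDerivAt_id θ).prodMk (hbd θ))
    simp only [hlev] at h2
    exact h2.unique (hasDerivAt_const θ c)
  have hw2 : ∀ᶠ h in 𝓝[≠] (0 : ℝ), TransBound
      (fun θ => h⁻¹ • ((θ + h, bd l (θ + h)) - (θ, bd l θ))) (0 + Y₁) := by
    filter_upwards [hY₁] with h hh
    exact TransBound.prodMk (by fun_prop) (by fun_prop) (hw1 h) hh
  obtain ⟨Y₂, hY₂⟩ := exists_diffQuot_bound hC₂ hL hLK (y := fun θ => (θ, bd l θ))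
    (by fun_prop) (hl.transBound_prodMk hK)
    (fun θ => ⟨hR' θ, by simpa using (hM' θ).trans_lt (lt_add_one M)⟩) hlev' hX
    (fun θ v => by rw [hF.fderiv_logFamilyAlong_snd, hΛf]) (M := max 1 M) (fun h θ => by
      rw [Prod.mk_sub_mk, Prod.norm_mk, max_mul_of_nonneg _ _ (abs_nonneg h)]
      refine max_le_max (by simp) ?_
      simpa using norm_sub_le_of_hasDerivAt hbd hM' θ (θ + h)) hw2
  obtain ⟨L', hL', hd', -⟩ := hL.exists_deriv hLK hY₂
  exact hl'.lipschitz_of_angular hL' hd'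

theorem holderOn_of_lipschitz {f : ℂ → ℂ} {C α : ℝ} (hα : 0 < α ∧ α < 1) (hC : 0 ≤ C)
    (hf : ∀ z ∈ closedBall (0 : ℂ) 1, ∀ w ∈ closedBall (0 : ℂ) 1, ‖f z - f w‖ ≤ C * ‖z - w‖) :
    HolderOn f (closedBall 0 1) α := by
  refine ⟨C * 2 ^ (1 - α), fun z hz w hw => (hf z hz w hw).trans ?_⟩
  rw [mul_assoc]
  refine mul_le_mul_of_nonneg_left ?_ hC
  have h2 : ‖z - w‖ ≤ 2 := by
    rw [mem_closedBall_zero_iff] at hz hw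
    linarith [norm_sub_le z w]
  rcases (norm_nonneg (z - w)).eq_or_lt with h0 | h0
  · rw [← h0]
    positivity
  · calc ‖z - w‖ = ‖z - w‖ ^ (1 - α) * ‖z - w‖ ^ α := by
          rw [← Real.rpow_add h0, sub_add_cancel, Real.rpow_one]
      _ ≤ _ := by
          gcongr
          linarith [hα.2]

theorem HolDisk.c1AlphaOnDisk_cexp {l l' : ℂ → ℂ} {C α : ℝ} (hα : 0 < α ∧ α < 1) (hl : HolDisk l)
    (hl' : HolDisk l') (hd : ∀ z ∈ ball (0 : ℂ) 1, HasDerivAt l (l' z) z) (hC : 0 ≤ C)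
    (hLip : ∀ z ∈ closedBall (0 : ℂ) 1, ∀ w ∈ closedBall (0 : ℂ) 1,
      ‖l' z - l' w‖ ≤ C * ‖z - w‖) : C1AlphaOnDisk (fun z => Complex.exp (l z)) α := by
  have hg' := hl.cexp.mul hl'
  have hgd : ∀ z ∈ ball (0 : ℂ) 1,
      HasDerivAt (fun z => Complex.exp (l z)) (Complex.exp (l z) * l' z) z :=
    fun z hz => (hd z hz).cexp
  refine ⟨_, hgd, hg'.1, ?_⟩
  obtain ⟨D, hD0, hD⟩ := hl.cexp.lipschitz hg' hgd
  obtain ⟨A, hA⟩ := hl.cexp.exists_bound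
  obtain ⟨B, hB⟩ := hl'.exists_bound
  have hA0 : 0 ≤ A := (norm_nonneg _).trans (hA 0 (by simp))
  have hB0 : 0 ≤ B := (norm_nonneg _).trans (hB 0 (by simp))
  refine holderOn_of_lipschitz (C := A * C + D * B) hα (by positivity) fun z hz w hw => ?_
  rw [show Complex.exp (l z) * l' z - Complex.exp (l w) * l' w
    = Complex.exp (l z) * (l' z - l' w) + (Complex.exp (l z) - Complex.exp (l w)) * l' w by ring]
  refine (norm_add_le _ _).trans ?_
  rw [norm_mul, norm_mul]
  calc _ ≤ A * (C * ‖z - w‖) + D * ‖z - w‖ * B := by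
        gcongr
        · exact hA z hz
        · exact hLip z hz w hw
        · exact hD z hz w hw
        · exact hB w hw
    _ = _ := by ring

/-- A nonvanishing disk of class `C^{1,α}` has a Lipschitz holomorphic logarithm. -/
theorem exists_log_disk {g : ℂ → ℂ} {α : ℝ} (hg : HolDisk g) (hC1 : C1AlphaOnDisk g α)
    (h0 : ∀ z ∈ closedBall (0 : ℂ) 1, g z ≠ 0) :
    ∃ l, HolDisk l ∧ (∃ K, TransBound (bd l) K) ∧
      ∀ z ∈ closedBall (0 : ℂ) 1, Complex.exp (l z) = g z := by
  obtain ⟨g', hg', hg'c, -⟩ := hC1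
  set r : ℂ → ℂ := fun z => (max 1 ‖z‖)⁻¹ • z with hr
  have hm : ∀ z : ℂ, 0 < max 1 ‖z‖ := fun z => lt_max_of_lt_left one_pos
  have hrc : Continuous r :=
    ((continuous_const.max continuous_norm).inv₀ fun z => (hm z).ne').smul continuous_id
  have hrm : ∀ z, r z ∈ closedBall (0 : ℂ) 1 := fun z => by
    rw [mem_closedBall_zero_iff, hr, norm_smul, norm_inv, Real.norm_eq_abs, abs_of_pos (hm z),
      inv_mul_le_iff₀ (hm z), mul_one]
    exact le_max_right _ _
  have hrid : ∀ z ∈ closedBall (0 : ℂ) 1, r z = z := fun z hz => by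
    rw [mem_closedBall_zero_iff] at hz
    rw [hr]
    simp only [max_eq_left hz, inv_one, one_smul]
  obtain ⟨l, hlc, hl⟩ := exists_continuous_log (a := fun z => g (r z))
    (hg.1.comp_continuous hrc hrm) fun z => h0 _ (hrm z)
  have hexp : ∀ z ∈ closedBall (0 : ℂ) 1, Complex.exp (l z) = g z := fun z hz => by
    rw [hl, hrid z hz]
  have hld : ∀ z ∈ ball (0 : ℂ) 1, HasDerivAt l (g' z / g z) z := fun z hz => by
    have h1 : HasDerivAt (fun z => Complex.exp (l z)) (g' z) z :=
      (hg' z hz).congr_of_eventuallyEq <|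
        EqOn.eventuallyEq_of_mem hexp (closedBall_mem_nhds_of_mem hz)
    have h2 := (differentiableAt_of_exp hlc.continuousAt h1.differentiableAt).hasDerivAt
    have h3 := h2.cexp.unique h1
    rw [hexp z (ball_subset_closedBall hz)] at h3
    rwa [← h3, mul_div_cancel_left₀ _ (h0 z (ball_subset_closedBall hz))]
  have hlH : HolDisk l := ⟨hlc.continuousOn, fun z hz => (hld z hz).differentiableAt.differentiableWithinAt⟩
  obtain ⟨C, hC⟩ := (isCompact_closedBall (0 : ℂ) 1).exists_bound_of_continuousOn
    (hg'c.div hg.1 h0)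
  have hC0 : 0 ≤ C := (norm_nonneg _).trans (hC 0 (by simp))
  have hLip := norm_sub_le_on_closedBall hlc.continuousOn hld
    fun z hz => hC z (ball_subset_closedBall hz)
  refine ⟨l, hlH, ⟨_, TransBound.of_lipschitz hlH.continuous_bd (C := C) fun x y => ?_⟩, hexp⟩
  refine (hLip _ (circleMap_mem_closedBall_one x) _ (circleMap_mem_closedBall_one y)).trans ?_
  have := (lipschitzWith_circleMap 0 1).dist_le_mul x y
  rw [dist_eq_norm, dist_eq_norm, Real.norm_eq_abs] at this
  refine mul_le_mul_of_nonneg_left ?_ hC0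
  simpa using this

end DiskRegularity

section Openness

open MeasureTheory Filter Topology

theorem TransBound.add {E : Type*} [NormedAddCommGroup E] {u v : ℝ → E} {K K' : ℝ}
    (hu : Continuous u) (hv : Continuous v) (hK : TransBound u K) (hK' : TransBound v K') :
    TransBound (fun θ => u θ + v θ) (2 ^ 2 * (K + K')) :=
  (hK.prodMk hu hv hK').comp_lipschitz (by fun_prop) (by fun_prop) fun θ θ' => by
    rw [Prod.mk_sub_mk, Prod.norm_mk, add_sub_add_comm]
    have h1 := norm_add_le (u θ' - u θ) (v θ' - v θ)
    have h2 := le_max_left ‖u θ' - u θ‖ ‖v θ' - v θ‖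
    have h3 := le_max_right ‖u θ' - u θ‖ ‖v θ' - v θ‖
    linarith

theorem mem_unitSphere_iff {l : ℂ} : l ∈ sphere (0 : ℂ) 1 ↔ ∃ θ : ℝ, circleMap 0 1 θ = l := by
  rw [← mem_range, range_circleMap, abs_one]

/-- Disks with boundary in a positive level of the family do not vanish on the circle. -/
theorem IsSmoothTorusFamily.disk_ne_zero {F : ℂ → ℂ → ℝ} (hF : IsSmoothTorusFamily F) {t : ℝ}
    {g : ℂ → ℂ} (hg : HolDisk g) (htr : DiskTraceIn g (TorusOf F t))
    (hnz : ∀ l ∈ ball (0 : ℂ) 1, g l ≠ 0) : ∀ l ∈ closedBall (0 : ℂ) 1, g l ≠ 0 := by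
  obtain ⟨-, -, ⟨ε, hε, hnear⟩, hpos, -, -⟩ := hF
  have hzero : ∀ l ∈ sphere (0 : ℂ) 1, F l 0 = 0 := fun l hl => by
    rw [hnear l hl 0 (by simpa using hε), map_zero]
  intro l hl hgl
  rcases (mem_closedBall_zero_iff.1 hl).lt_or_eq with h | h
  · exact hnz l (mem_ball_zero_iff.2 h) hgl
  have hl' : l ∈ sphere (0 : ℂ) 1 := mem_sphere_zero_iff_norm.2 h
  have ht : t = 0 := by
    have := (htr l hl').2
    simp only [hgl, hzero l hl'] at this
    exact this.symm
  have h0 : ‖g 0‖ ≤ 0 := hg.norm_le_of_bd (fun θ => ?_) (by simp)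
  · exact hnz 0 (by simp) (norm_le_zero_iff.1 h0)
  · by_contra h1
    have h2 := hpos _ (circleMap_mem_unitSphere θ) (bd g θ) fun h2 => h1 (by rw [h2, norm_zero])
    have h3 := (htr _ (circleMap_mem_unitSphere θ)).2
    change F (circleMap 0 1 θ) (bd g θ) = t at h3
    linarith

/-- The logarithm of a disk with boundary in a level set of the family deforms to the
neighbouring level sets. -/
theorem IsSmoothTorusFamily.exists_log_deformation {F : ℂ → ℂ → ℝ} (hF : IsSmoothTorusFamily F)
    {l : ℂ → ℂ} {K c : ℝ} (hl : HolDisk l) (hK : TransBound (bd l) K)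
    (hlev : ∀ θ, logFamily F (θ, bd l θ) = c) :
    ∃ δ, 0 < δ ∧ ∃ v : ℝ → ℂ → ℂ,
      (∀ s, |s| < δ → HolDisk (v s) ∧ TransBound (bd (v s)) 1 ∧
        ∀ θ, logFamily F (θ, bd l θ + bd (v s) θ) = c + s) ∧
      ContinuousOn (fun p : ℂ × ℝ => v p.2 p.1) (closedBall 0 1 ×ˢ Ioo (-δ) δ) ∧
      ∀ z ∈ closedBall 0 1, v 0 z = 0 := by
  obtain ⟨Λ, hΛ, hΛp, hΛf⟩ := hF.exists_phase
  obtain ⟨X, hX⟩ := exists_H1Bound_phase hΛ hΛp hl hK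
  obtain ⟨R, hR⟩ := hl.exists_mem_strip
  have hR' : ∀ θ, (θ, bd l θ) ∈ strip R := fun θ => by simpa using hR θ 0 (by simp)
  have hlc := hl.continuous_bd
  obtain ⟨C, hC⟩ := LipschitzDerivOn.of_periodic (contDiff_infty.1 hF.contDiff_logFamily 2)
    (logFamily_periodic F) (isCompact_strip R) (strip_reduction R) (convex_strip R)
  have hEc := hF.contDiff_logFamily.continuous
  have hXc := hX.continuous
  have hΛX : ∀ θ, Λ (θ + 2 * Real.pi, bd l (θ + 2 * Real.pi)) = Λ (θ, bd l θ) := hX.periodic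
  have hper : ∀ θ v, logFamily F (θ + 2 * Real.pi, bd l (θ + 2 * Real.pi) + v)
      = logFamily F (θ, bd l θ + v) := fun θ v => by
    rw [← logFamily_periodic F (θ, bd l θ + v), bd_periodic, Prod.mk_add_mk, add_zero]
  obtain ⟨δ, hδ, v, hv, hvc, hv0⟩ := exists_small_solutions hX
    (N := fun θ v => logFamily F (θ, bd l θ + v) - logFamily F (θ, bd l θ)
      - (Complex.exp (Λ (θ, bd l θ)) * v).re) (by fun_prop)
    (fun θ v => by
      have h1 := hper θ 0
      rw [add_zero, add_zero] at h1
      rw [hper, h1, hΛX θ])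
    (fun θ => by simp) (q := fun θ => (θ, bd l θ)) (C := 3 * C) (by fun_prop)
    (hl.transBound_prodMk hK) (fun θ θ' v v' hv hv' => by
      have := hC.remainder_sub_le (p := (θ, bd l θ)) (v := (0, v)) (p' := (θ', bd l θ'))
        (v' := (0, v')) (hR' θ) (by simpa using hR θ v (by simpa using hv)) (hR' θ')
        (by simpa using hR θ' v' (by simpa using hv'))
      simpa [hΛf, Prod.norm_mk] using this)
  refine ⟨δ, hδ, v, fun s hs => ?_, hvc, hv0⟩
  obtain ⟨h1, h2, -, h3⟩ := hv s hs
  refine ⟨h1, h2, fun θ => ?_⟩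
  have := h3 θ
  rw [hlev] at this
  linarith

end Openness

/-- **Openness for one disk.** If `g₀ ∈ C^{1,α}(Δ̄)` defines a nonvanishing holomorphic disk
with trace in the torus `Γ^{t₀}` of a smooth family of graphical tori, then for `t` near `t₀`
there is a continuous family of such disks `g^t` with traces in `Γ^t` and `g^{t₀} = g₀`. -/
theorem openness_one_disk (F : ℂ → ℂ → ℝ) (hF : IsSmoothTorusFamily F)
    (t₀ : ℝ) (ht₀ : 0 ≤ t₀) (α : ℝ) (hα : 0 < α ∧ α < 1)
    (g₀ : ℂ → ℂ) (hg₀ : HolDisk g₀) (htr : DiskTraceIn g₀ (TorusOf F t₀))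
    (hC1 : C1AlphaOnDisk g₀ α) (hnz : ∀ l ∈ ball (0 : ℂ) 1, g₀ l ≠ 0) :
    ∃ δ : ℝ, 0 < δ ∧ ∃ G : ℂ → ℝ → ℂ,
      ContinuousOn (fun q : ℂ × ℝ => G q.1 q.2)
        (closedBall (0 : ℂ) 1 ×ˢ Ioo (t₀ - δ) (t₀ + δ)) ∧
      (∀ l ∈ closedBall (0 : ℂ) 1, G l t₀ = g₀ l) ∧
      ∀ t : ℝ, |t - t₀| < δ → 0 ≤ t →
        HolDisk (fun l => G l t) ∧ DiskTraceIn (fun l => G l t) (TorusOf F t) ∧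
        C1AlphaOnDisk (fun l => G l t) α ∧ ∀ l ∈ ball (0 : ℂ) 1, G l t ≠ 0 := by
  have hnz' := hF.disk_ne_zero hg₀ htr hnz
  obtain ⟨l, hl, ⟨K, hK⟩, hexp⟩ := exists_log_disk hg₀ hC1 hnz'
  have hlev : ∀ θ, logFamily F (θ, bd l θ) = t₀ := fun θ => by
    rw [logFamily, bd, hexp _ (circleMap_mem_closedBall_one θ)]
    exact (htr _ (circleMap_mem_unitSphere θ)).2
  obtain ⟨δ, hδ, v, hv, hvc, hv0⟩ := hF.exists_log_deformation hl hK hlev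
  refine ⟨δ, hδ, fun z t => Complex.exp (l z + v (t - t₀) z), ?_, fun z hz => ?_, fun t ht _ => ?_⟩
  · refine ContinuousOn.cexp (ContinuousOn.add ?_ ?_)
    · exact hl.1.comp continuousOn_fst fun p hp => hp.1
    · exact hvc.comp (f := fun p : ℂ × ℝ => (p.1, p.2 - t₀)) (by fun_prop)
        fun p hp => ⟨hp.1, by linarith [hp.2.1], by linarith [hp.2.2]⟩
  · simp only [sub_self, hv0 z hz, add_zero, hexp z hz]
  · obtain ⟨hvH, hvK, hvE⟩ := hv _ ht
    have hL := hl.add hvH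
    have hLlev : ∀ θ, logFamily F (θ, bd (fun z => l z + v (t - t₀) z) θ) = t := fun θ =>
      (hvE θ).trans (add_sub_cancel t₀ t)
    obtain ⟨l', hl', hd, C, hC, hLip⟩ := hF.exists_lipschitz_deriv hL
      (hK.add hl.continuous_bd hvH.continuous_bd hvK) hLlev
    refine ⟨hL.cexp, fun z hz => ⟨hz, ?_⟩, hL.c1AlphaOnDisk_cexp hα hl' hd hC hLip,
      fun z _ => Complex.exp_ne_zero _⟩
    obtain ⟨θ, rfl⟩ := mem_unitSphere_iff.1 hz
    exact hLlev θ
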